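/- Let F be a finite field of characteristic different from 2 equipped with a nonidentity involution a ↦ ā. Every square matrix A over F is *congruent to a direct sum, uniquely determined up to permutation of summands, of matrices of the following types: (i) J_n(0); (ii) [Φ ⟍ I_n], where Φ is an n×n nonsingular Frobenius block such that p_Φ(x) ≠ p_Φ^∨(x), and Φ is determined up to replacement by the Frobenius block Ψ with χ_Ψ(x) = χ_Φ^∨(x); (iii) √*Φ, where Φ is a nonsingular Frobenius block such that p_Φ(x) = p_Φ^∨(x). -/

import Mathlib

open Polynomial Matrix

namespace Can

noncomputable section

abbrev Mat (F : Type*) (n : ℕ) := Matrix (Fin n) (Fin n) F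

variable {F : Type*} [Field F]

/-- conjugate transpose w.r.t. an involution σ -/
def ctr (σ : F →+* F) {m n : ℕ} (A : Matrix (Fin m) (Fin n) F) : Matrix (Fin n) (Fin m) F :=
  (A.map σ)ᵀ

/-- congruence: SᵀAS = B for a nonsingular S -/
def Congruent {n : ℕ} (A B : Mat F n) : Prop :=
  ∃ S : Mat F n, IsUnit S.det ∧ Sᵀ * A * S = B

/-- *congruence: S*AS = B for a nonsingular S -/
def StarCongruent (σ : F →+* F) {n : ℕ} (A B : Mat F n) : Prop :=
  ∃ S : Mat F n, IsUnit S.det ∧ ctr σ S * A * S = B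

/-- a square-matrix "summand" of unspecified size -/
abbrev Block (F : Type*) := Σ n : ℕ, Mat F n

def castMat {m n : ℕ} (h : m = n) (A : Mat F m) : Mat F n :=
  Matrix.reindex (finCongr h) (finCongr h) A

def BCong (X Y : Block F) : Prop :=
  ∃ h : X.1 = Y.1, Congruent (castMat h X.2) Y.2

def BStarCong (σ : F →+* F) (X Y : Block F) : Prop :=
  ∃ h : X.1 = Y.1, StarCongruent σ (castMat h X.2) Y.2

/-- direct sum of a list of blocks -/
def bsum : List (Block F) → Block F
  | [] => ⟨0, 0⟩
  | X :: L => ⟨X.1 + (bsum L).1,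
      Matrix.reindex finSumFinEquiv finSumFinEquiv (Matrix.fromBlocks X.2 0 0 (bsum L).2)⟩

/-- pairs of square matrices of the same size -/
abbrev PBlock (F : Type*) := Σ n : ℕ, Mat F n × Mat F n

def PCong (X Y : PBlock F) : Prop :=
  ∃ h : X.1 = Y.1, ∃ S : Mat F Y.1, IsUnit S.det ∧
    Sᵀ * castMat h X.2.1 * S = Y.2.1 ∧ Sᵀ * castMat h X.2.2 * S = Y.2.2

def PStarCong (σ : F →+* F) (X Y : PBlock F) : Prop :=
  ∃ h : X.1 = Y.1, ∃ S : Mat F Y.1, IsUnit S.det ∧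
    ctr σ S * castMat h X.2.1 * S = Y.2.1 ∧ ctr σ S * castMat h X.2.2 * S = Y.2.2

def psum : List (PBlock F) → PBlock F
  | [] => ⟨0, (0, 0)⟩
  | X :: L =>
      ⟨X.1 + (psum L).1,
        (Matrix.reindex finSumFinEquiv finSumFinEquiv (Matrix.fromBlocks X.2.1 0 0 (psum L).2.1),
         Matrix.reindex finSumFinEquiv finSumFinEquiv (Matrix.fromBlocks X.2.2 0 0 (psum L).2.2))⟩

/-- lower-triangular Jordan block -/
def J (F : Type*) [Field F] (n : ℕ) (lam : F) : Mat F n :=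
  Matrix.of fun i j => if i = j then lam else if (i : ℕ) = (j : ℕ) + 1 then 1 else 0

/-- the companion (Frobenius) matrix of a polynomial -/
def companion (F : Type*) [Field F] (f : Polynomial F) : Mat F f.natDegree :=
  Matrix.of fun i j => if (i : ℕ) = (j : ℕ) + 1 then 1
    else if (j : ℕ) + 1 = f.natDegree then -f.coeff i else 0

/-- f ↦ f^∨ (with respect to the involution σ) -/
def dualPoly (σ : F →+* F) (f : Polynomial F) : Polynomial F :=
  Polynomial.C (σ (f.coeff 0))⁻¹ * (f.map σ).reverse

/-- the skew sum [A ⟍ B] = [[0, B], [A, 0]] -/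
def skewSum {k l : ℕ} (A : Matrix (Fin k) (Fin l) F) (B : Matrix (Fin l) (Fin k) F) :
    Mat F (l + k) :=
  Matrix.reindex finSumFinEquiv finSumFinEquiv (Matrix.fromBlocks 0 B A 0)

/-- the matrix Γₙ -/
def Gamma (F : Type*) [Field F] (n : ℕ) : Mat F n :=
  Matrix.of fun i j =>
    if (i : ℕ) + (j : ℕ) + 1 = n ∨ (i : ℕ) + (j : ℕ) = n then (-1 : F) ^ (n - 1 - (i : ℕ)) else 0

/-- Fₙ = [I | 0], an (n−1)×n matrix -/
def Fmat (F : Type*) [Field F] (n : ℕ) : Matrix (Fin (n - 1)) (Fin n) F :=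
  Matrix.of fun i j => if (i : ℕ) = (j : ℕ) then 1 else 0

/-- Gₙ = [0 | I], an (n−1)×n matrix -/
def Gmat (F : Type*) [Field F] (n : ℕ) : Matrix (Fin (n - 1)) (Fin n) F :=
  Matrix.of fun i j => if (i : ℕ) + 1 = (j : ℕ) then 1 else 0

/-- the pair Bₙ of symmetric n×n matrices -/
def Bpair (F : Type*) [Field F] (n : ℕ) : Mat F n × Mat F n :=
  (Matrix.of fun i j => if (i : ℕ) + (j : ℕ) + 2 = n then 1 else 0,
   Matrix.of fun i j => if (i : ℕ) + (j : ℕ) + 1 = n then 1 else 0)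

/-- the pair Cₙ of a symmetric and a skew-symmetric n×n matrix -/
def Cpair (F : Type*) [Field F] (n : ℕ) : Mat F n × Mat F n :=
  if Odd n then
    (Matrix.of fun i j => if (i : ℕ) + (j : ℕ) + 1 = n then 1 else 0,
     Matrix.of fun i j =>
       if (i : ℕ) + (j : ℕ) + 2 = n ∧ i < j then 1
       else if (i : ℕ) + (j : ℕ) + 2 = n ∧ j < i then -1 else 0)
  else
    (Matrix.of fun i j => if (i : ℕ) + (j : ℕ) + 2 = n then 1 else 0,
     Matrix.of fun i j =>
       if (i : ℕ) + (j : ℕ) + 1 = n ∧ i < j then 1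
       else if (i : ℕ) + (j : ℕ) + 1 = n ∧ j < i then -1 else 0)

/-- at most one entry of the list satisfies P -/
def AtMostOne {α : Type*} (P : α → Prop) (L : List α) : Prop :=
  ¬ ∃ b₁ b₂ : α, List.Sublist [b₁, b₂] L ∧ P b₁ ∧ P b₂


section Stmt1
variable {F : Type*} [Field F] (σ : F →+* F)

def skewIBlock1 (χ : Polynomial F) : Block F :=
  ⟨χ.natDegree + χ.natDegree, skewSum (companion F χ) (1 : Mat F χ.natDegree)⟩

/-- type (i): Jₙ(0) -/
def T1i (b : Block F) : Prop := ∃ n : ℕ, 0 < n ∧ b = ⟨n, J F n 0⟩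

/-- type (ii): [Φ ⟍ Iₙ], Φ a nonsingular Frobenius block with p_Φ ≠ p_Φ^∨ -/
def T1ii (b : Block F) : Prop :=
  ∃ (pp : Polynomial F) (l : ℕ), pp.Monic ∧ Irreducible pp ∧ 0 < l ∧ (pp ^ l).eval 0 ≠ 0 ∧
    dualPoly σ pp ≠ pp ∧ b = skewIBlock1 (pp ^ l)

/-- type (iii): √*Φ, Φ a nonsingular Frobenius block with p_Φ = p_Φ^∨ -/
def T1iii (sqrtS : (q : Polynomial F) → Mat F q.natDegree) (b : Block F) : Prop :=
  ∃ (pp : Polynomial F) (l : ℕ), pp.Monic ∧ Irreducible pp ∧ 0 < l ∧ (pp ^ l).eval 0 ≠ 0 ∧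
    dualPoly σ pp = pp ∧ b = ⟨(pp ^ l).natDegree, sqrtS (pp ^ l)⟩

def Equiv1 (b c : Block F) : Prop :=
  b = c ∨
  ∃ (pp : Polynomial F) (l : ℕ), pp.Monic ∧ Irreducible pp ∧ 0 < l ∧ (pp ^ l).eval 0 ≠ 0 ∧
    dualPoly σ pp ≠ pp ∧
    b = skewIBlock1 (pp ^ l) ∧ c = skewIBlock1 (dualPoly σ (pp ^ l))

section NormEquation

lemma exists_sq_sub_mul_sq_of_field {K : Type*} [Field K] [Finite K] (h2 : (2 : K) ≠ 0)
    {d : K} (hd : d ≠ 0) (a : K) : ∃ u v : K, u ^ 2 - d * v ^ 2 = a := by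
  have := Fintype.ofFinite K
  have hodd : Fintype.card K % 2 = 1 := by
    apply FiniteField.odd_card_of_char_ne_two
    intro h
    apply h2
    have := ringChar.Nat.cast_ringChar (R := K)
    rw [h] at this
    exact_mod_cast this
  obtain ⟨u, v, h⟩ := FiniteField.exists_root_sum_quadratic (R := K)
    (f := X ^ 2 - C a) (g := C (-d) * X ^ 2) (degree_X_pow_sub_C (by norm_num) a)
    (degree_C_mul_X_pow 2 (neg_ne_zero.2 hd)) hodd
  refine ⟨u, v, ?_⟩
  simp at h
  linear_combination h

lemma exists_sq_eq_one_add_of_isNilpotent {R : Type*} [CommRing R] {p : ℕ} (hp : p.Prime)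
    (hp2 : p ≠ 2) (hpR : (p : R) = 0) {ν : R} (hν : IsNilpotent ν) : ∃ t : R, t ^ 2 = 1 + ν := by
  obtain ⟨k, hk⟩ := hν
  have h0 : ν ^ p ^ k = 0 := pow_eq_zero_of_le (Nat.lt_pow_self hp.one_lt).le hk
  obtain ⟨r, hr⟩ := exists_add_pow_prime_pow_eq hp 1 ν k
  rw [h0, hpR] at hr
  obtain ⟨m, hm⟩ : Odd (p ^ k) := (hp.odd_of_ne_two hp2).pow
  refine ⟨(1 + ν) ^ (m + 1), ?_⟩
  calc ((1 + ν) ^ (m + 1)) ^ 2 = (1 + ν) ^ (p ^ k) * (1 + ν) := by rw [hm]; ring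
    _ = 1 + ν := by rw [hr]; ring

lemma exists_sq_sub_mul_sq_of_isReduced {R : Type*} [CommRing R] [Finite R] [IsReduced R]
    (h2 : IsUnit (2 : R)) {d : R} (hd : IsUnit d) (a : R) : ∃ u v : R, u ^ 2 - d * v ^ 2 = a := by
  have key : ∀ m : MaximalSpectrum R, ∃ u v : R ⧸ m.asIdeal,
      u ^ 2 - Ideal.Quotient.mk m.asIdeal d * v ^ 2 = Ideal.Quotient.mk m.asIdeal a := by
    intro m
    have := m.isMaximal
    let _ := Ideal.Quotient.field m.asIdeal
    have : Finite (R ⧸ m.asIdeal) := Finite.of_surjective _ Ideal.Quotient.mk_surjective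
    refine exists_sq_sub_mul_sq_of_field ?_ (hd.map (Ideal.Quotient.mk m.asIdeal)).ne_zero _
    simpa only [map_ofNat] using (h2.map (Ideal.Quotient.mk m.asIdeal)).ne_zero
  choose u v huv using key
  refine ⟨(IsArtinianRing.equivPi R).symm u, (IsArtinianRing.equivPi R).symm v, ?_⟩
  apply (IsArtinianRing.equivPi R).injective
  ext m
  have hs : ∀ w, Ideal.Quotient.mk m.asIdeal ((IsArtinianRing.equivPi R).symm w) = w m := by
    intro w
    rw [← IsArtinianRing.equivPi_apply, AlgEquiv.apply_symm_apply]
  simpa [hs] using huv m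

lemma exists_sq_sub_mul_sq {R : Type*} [CommRing R] [Finite R] {p : ℕ} (hp : p.Prime)
    (hp2 : p ≠ 2) (hpR : (p : R) = 0) (h2 : IsUnit (2 : R)) {d a : R} (hd : IsUnit d)
    (ha : IsUnit a) : ∃ u v : R, u ^ 2 - d * v ^ 2 = a := by
  have : IsReduced (R ⧸ nilradical R) :=
    (Ideal.isRadical_iff_quotient_reduced _).1 (Ideal.radical_isRadical _)
  have : Finite (R ⧸ nilradical R) := Finite.of_surjective _ Ideal.Quotient.mk_surjective
  let π := Ideal.Quotient.mk (nilradical R)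
  obtain ⟨u', v', h⟩ := exists_sq_sub_mul_sq_of_isReduced (R := R ⧸ nilradical R)
    (by simpa only [π, map_ofNat] using h2.map π) (hd.map π) (π a)
  obtain ⟨u, rfl⟩ := Ideal.Quotient.mk_surjective u'
  obtain ⟨v, rfl⟩ := Ideal.Quotient.mk_surjective v'
  have hn : IsNilpotent (u ^ 2 - d * v ^ 2 - a) := by
    rw [← mem_nilradical, ← Ideal.Quotient.eq]
    simpa using h
  obtain ⟨w, hw⟩ := hn.isUnit_add_left_of_commute ha (Commute.all _ _)
  have hnil : IsNilpotent ((↑w⁻¹ : R) * -(u ^ 2 - d * v ^ 2 - a)) :=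
    (Commute.all _ _).isNilpotent_mul_left hn.neg
  obtain ⟨t, ht⟩ := exists_sq_eq_one_add_of_isNilpotent hp hp2 hpR hnil
  refine ⟨u * t, v * t, ?_⟩
  have hw' : (w : R) = u ^ 2 - d * v ^ 2 := by rw [hw]; ring
  calc (u * t) ^ 2 - d * (v * t) ^ 2 = w * t ^ 2 := by rw [hw']; ring
    _ = w + (w * ↑w⁻¹) * -(u ^ 2 - d * v ^ 2 - a) := by rw [ht]; ring
    _ = a := by rw [Units.mul_inv, hw']; ring

end NormEquation

section Forms
variable {F : Type*} [Field F] {σ : F →+* F}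
variable {V V' V'' : Type*} [AddCommGroup V] [Module F V] [AddCommGroup V'] [Module F V']
  [AddCommGroup V''] [Module F V'']

/-- isometry of sesquilinear forms -/
def Isom (B : V →ₛₗ[σ] V →ₗ[F] F) (B' : V' →ₛₗ[σ] V' →ₗ[F] F) : Prop :=
  ∃ e : V ≃ₗ[F] V', ∀ x y, B' (e x) (e y) = B x y

lemma Isom.symm {B : V →ₛₗ[σ] V →ₗ[F] F} {B' : V' →ₛₗ[σ] V' →ₗ[F] F} (h : Isom B B') :
    Isom B' B := by
  obtain ⟨e, he⟩ := h
  exact ⟨e.symm, fun x y => by simp [← he]⟩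

lemma Isom.trans {B : V →ₛₗ[σ] V →ₗ[F] F} {B' : V' →ₛₗ[σ] V' →ₗ[F] F}
    {B'' : V'' →ₛₗ[σ] V'' →ₗ[F] F} (h : Isom B B') (h' : Isom B' B'') : Isom B B'' := by
  obtain ⟨e, he⟩ := h
  obtain ⟨e', he'⟩ := h'
  exact ⟨e.trans e', fun x y => by simp [← he, ← he']⟩

/-- A self-adjoint automorphism of a form over a finite field with nontrivial involution is a
norm. -/
lemma exists_norm_eq_of_selfAdjoint [Finite F] [FiniteDimensional F V] (hchar : (2 : F) ≠ 0)
    (hσinv : ∀ a, σ (σ a) = a) (hσ : σ ≠ RingHom.id F) (B : V →ₛₗ[σ] V →ₗ[F] F)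
    (M : Module.End F V) (hM : IsUnit M) (hB : ∀ x y, B (M x) y = B x (M y)) :
    ∃ N : Module.End F V, IsUnit N ∧ ∀ x y, B (N x) (N y) = B x (M y) := by
  obtain ⟨c, hc⟩ : ∃ c, σ c ≠ c := by
    by_contra! h
    exact hσ (RingHom.ext h)
  set e := c - σ c with he
  have hσe : σ e = -e := by simp [he, hσinv]
  have he0 : e ≠ 0 := by rw [he, sub_ne_zero]; exact hc.symm
  have : Finite V := Module.finite_of_finite F
  have : Finite (Module.End F V) := Finite.of_injective (fun f : Module.End F V => (f : V → V))
    DFunLike.coe_injective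
  let D : Module.End F V := (e ^ 2) • 1
  let s : Set (Module.End F V) := {M, D}
  have hcomm : ∀ x ∈ s, ∀ y ∈ s, x * y = y * x := by
    rintro x (rfl | rfl) y (rfl | rfl) <;> simp [D]
  let _ : CommRing (Subring.closure s) :=
    { (inferInstance : Ring (Subring.closure s)) with
      mul_comm := (Subring.isMulCommutative_closure hcomm).is_comm.comm }
  have hself : ∀ f ∈ Subring.closure s, ∀ x y, B (f x) y = B x (f y) := by
    intro f hf
    induction hf using Subring.closure_induction with
    | mem f hf =>
      rcases hf with rfl | rfl
      · exact hB
      · intro x y; simp [D, hσe]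
    | zero => simp
    | one => simp
    | add f g _ _ hf hg => intro x y; simp [hf, hg]
    | neg f _ hf => intro x y; simp [hf]
    | mul f g hf' hg' hf hg =>
      intro x y
      have : f * g = g * f :=
        congrArg Subtype.val (mul_comm (⟨f, hf'⟩ : Subring.closure s) ⟨g, hg'⟩)
      rw [Module.End.mul_apply, hf, hg, this, Module.End.mul_apply]
  have hunit : ∀ f : Subring.closure s, IsUnit (f : Module.End F V) → IsUnit f := by
    intro f hf
    obtain ⟨n, hn, h⟩ := (isOfFinOrder_of_finite hf.unit).exists_pow_eq_one
    refine IsUnit.of_pow_eq_one (n := n) (Subtype.ext ?_) hn.ne'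
    have := congrArg Units.val h
    simpa using this
  have hp : (ringChar F).Prime := by
    have := Fintype.ofFinite F
    exact CharP.char_is_prime F _
  obtain ⟨u, v, huv⟩ := exists_sq_sub_mul_sq (R := Subring.closure s) hp
    (fun h => hchar (by have := ringChar.Nat.cast_ringChar (R := F); rw [h] at this; exact_mod_cast this))
    (Subtype.ext (by
      have h1 : ((ringChar F : ℕ) : Module.End F V) = ((ringChar F : ℕ) : F) • 1 := by
        ext x; simp [← Nat.cast_smul_eq_nsmul F]
      have h2 : (((ringChar F : ℕ) : Subring.closure s) : Module.End F V) = (ringChar F : ℕ) := by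
        push_cast; rfl
      rw [h2, h1]; simp))
    (hunit 2 (by
      have h1 : ((2 : Subring.closure s) : Module.End F V) = algebraMap F (Module.End F V) 2 := by
        rw [map_ofNat]; rfl
      rw [h1]; exact (isUnit_iff_ne_zero.2 hchar).map _))
    (d := ⟨D, Subring.subset_closure (by simp [s])⟩)
    (a := ⟨M, Subring.subset_closure (by simp [s])⟩)
    (hunit _ ((isUnit_iff_ne_zero.2 (pow_ne_zero 2 he0)).map (algebraMap F (Module.End F V))))
    (hunit _ hM)
  have huv' : (u : Module.End F V) * u - D * (v * v) = M := by
    have := congrArg Subtype.val huv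
    simpa [sq] using this
  have hcom : (u : Module.End F V) * v = v * u := congrArg Subtype.val (mul_comm u v)
  have hfac : ((u : Module.End F V) - e • v) * (u + e • v) = M := by
    rw [← huv', sub_mul, mul_add, mul_add]
    simp only [mul_smul_comm, smul_mul_assoc, D, one_mul, hcom, smul_smul]
    rw [sq]; abel
  refine ⟨(u : Module.End F V) + e • (v : Module.End F V), ?_, fun x y => ?_⟩
  · have : IsUnit (((u : Module.End F V) - e • v) * (u + e • v)) := hfac ▸ hM
    rw [Module.End.isUnit_iff] at this ⊢
    exact (Module.End.isUnit_iff _).1 ((LinearMap.isUnit_iff_ker_eq_bot _).2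
      (LinearMap.ker_eq_bot.2 (Function.Injective.of_comp (f := (u : Module.End F V) - e • (v : Module.End F V))
        this.injective)))
  · rw [← hfac]
    simp only [LinearMap.add_apply, LinearMap.smul_apply, map_add, LinearMap.map_smulₛₗ, hσe,
      Module.End.mul_apply, LinearMap.sub_apply, map_sub, hself u u.2, hself v v.2]
    simp
    ring

/-- Forms whose associated pencils are equivalent are isometric. -/
lemma Isom.of_weak [Finite F] [FiniteDimensional F V] (hchar : (2 : F) ≠ 0)
    (hσinv : ∀ a, σ (σ a) = a) (hσ : σ ≠ RingHom.id F)
    {B : V →ₛₗ[σ] V →ₗ[F] F} {B' : V' →ₛₗ[σ] V' →ₗ[F] F} (f g : V ≃ₗ[F] V')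
    (h : ∀ x y, B' (f x) (g y) = B x y) (h' : ∀ x y, B' (g x) (f y) = B x y) : Isom B B' := by
  let B'' : V →ₛₗ[σ] V →ₗ[F] F := (B'.comp f.toLinearMap).compl₂ f.toLinearMap
  have hB'' : ∀ x y, B'' x y = B' (f x) (f y) := fun x y => rfl
  let M : V ≃ₗ[F] V := g.trans f.symm
  have hM : ∀ x y, B'' x (M y) = B x y := by intro x y; simp [hB'', M, h]
  have hM' : ∀ x y, B'' (M x) y = B x y := by intro x y; simp [hB'', M, h']
  obtain ⟨N, hN, hBN⟩ := exists_norm_eq_of_selfAdjoint hchar hσinv hσ B'' M.toLinearMap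
    ((Module.End.isUnit_iff _).2 M.bijective) (fun x y => by simp [hM, hM'])
  refine ⟨(LinearEquiv.ofBijective N ((Module.End.isUnit_iff _).1 hN)).trans f, fun x y => ?_⟩
  rw [← hM x y]
  exact hBN x y

end Forms

section Duality
variable {F : Type*} [Field F] {σ : F →+* F}
variable {V V' : Type*} [AddCommGroup V] [Module F V] [AddCommGroup V'] [Module F V']

/-- the restriction of a sesquilinear form to a subspace -/
def restr (B : V →ₛₗ[σ] V →ₗ[F] F) (M : Submodule F V) : M →ₛₗ[σ] M →ₗ[F] F :=
  (B.comp M.subtype).compl₂ M.subtype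

@[simp] lemma restr_apply (B : V →ₛₗ[σ] V →ₗ[F] F) (M : Submodule F V) (x y : M) :
    restr B M x y = B x y := rfl

/-- the linear functional `x ↦ σ (B x y)` -/
def conjFun (hσinv : ∀ a, σ (σ a) = a) (B : V →ₛₗ[σ] V →ₗ[F] F) (y : V) : V →ₗ[F] F where
  toFun x := σ (B x y)
  map_add' := by simp
  map_smul' := by simp [hσinv]

@[simp] lemma conjFun_apply (hσinv : ∀ a, σ (σ a) = a) (B : V →ₛₗ[σ] V →ₗ[F] F) (x y : V) :
    conjFun hσinv B y x = σ (B x y) := rfl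

lemma exists_mem_form_eq [FiniteDimensional F V] (hσinv : ∀ a, σ (σ a) = a)
    (B : V →ₛₗ[σ] V →ₗ[F] F) (S : Submodule F V) (f : V →ₗ[F] F)
    (hf : ∀ x, (∀ s ∈ S, B s x = 0) → f x = 0) : ∃ s ∈ S, ∀ x, B s x = f x := by
  have : RingHomSurjective σ := ⟨fun a => ⟨σ a, hσinv a⟩⟩
  have h : f ∈ (S.map B).dualCoannihilator.dualAnnihilator := by
    rw [Submodule.mem_dualAnnihilator]
    intro x hx
    rw [Submodule.mem_dualCoannihilator] at hx
    exact hf x fun s hs => hx _ (Submodule.mem_map_of_mem hs)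
  rw [Subspace.dualCoannihilator_dualAnnihilator_eq] at h
  obtain ⟨s, hs, rfl⟩ := h
  exact ⟨s, hs, fun x => rfl⟩

/-- a form with trivial right radical -/
def RNondeg (B : V →ₛₗ[σ] V →ₗ[F] F) : Prop := ∀ y, (∀ x, B x y = 0) → y = 0

lemma RNondeg.bijective [Finite F] [FiniteDimensional F V] (hσinv : ∀ a, σ (σ a) = a)
    {B : V →ₛₗ[σ] V →ₗ[F] F} (hB : RNondeg B) : Function.Bijective B := by
  have : Finite V := Module.finite_of_finite F
  refine Function.Surjective.bijective_of_nat_card_le (fun f => ?_) ?_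
  · obtain ⟨s, -, hs⟩ := exists_mem_form_eq hσinv B ⊤ f (fun x hx => by
      rw [hB x fun s => hx s trivial, map_zero])
    exact ⟨s, LinearMap.ext hs⟩
  · rw [Module.natCard_eq_pow_finrank (K := F) (V := V), Module.natCard_eq_pow_finrank (K := F) (V := V →ₗ[F] F)]
    exact (congrArg _ (Subspace.dual_finrank_eq (K := F) (V := V)).symm).le

lemma RNondeg.exists_cosquare [Finite F] [FiniteDimensional F V] (hσinv : ∀ a, σ (σ a) = a)
    {B : V →ₛₗ[σ] V →ₗ[F] F} (hB : RNondeg B) :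
    ∃ φ : V ≃ₗ[F] V, ∀ x y, B x y = σ (B (φ y) x) := by
  have hbij := hB.bijective hσinv
  choose φ hφ using fun y => hbij.2 (conjFun hσinv B y)
  have hφ' : ∀ y x, B (φ y) x = σ (B x y) := fun y x => by rw [hφ]; rfl
  let Φ : V →ₗ[F] V :=
    { toFun := φ
      map_add' := fun x y => hbij.1 (by ext z; simp [hφ'])
      map_smul' := fun c x => hbij.1 (by ext z; simp [hφ']) }
  have hinj : Function.Injective Φ := by
    rw [injective_iff_map_eq_zero]
    intro y hy
    refine hB y fun x => ?_
    have : B (φ y) x = 0 := by rw [show φ y = 0 from hy]; simp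
    rw [hφ'] at this
    simpa using this
  exact ⟨LinearEquiv.ofInjectiveEndo Φ hinj, fun x y => by
    change B x y = σ (B (φ y) x)
    rw [hφ', hσinv]⟩

/-- Nondegenerate forms with similar cosquares are isometric. -/
lemma Isom.of_cosquare [Finite F] [FiniteDimensional F V] (hchar : (2 : F) ≠ 0)
    (hσinv : ∀ a, σ (σ a) = a) (hσ : σ ≠ RingHom.id F)
    {B : V →ₛₗ[σ] V →ₗ[F] F} {B' : V' →ₛₗ[σ] V' →ₗ[F] F} (hB : RNondeg B) (hB' : RNondeg B')
    (φ : V ≃ₗ[F] V) (φ' : V' ≃ₗ[F] V') (hφ : ∀ x y, B x y = σ (B (φ y) x))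
    (hφ' : ∀ x y, B' x y = σ (B' (φ' y) x)) (g : V ≃ₗ[F] V') (hg : ∀ x, g (φ x) = φ' (g x)) :
    Isom B B' := by
  have : FiniteDimensional F V' := g.finiteDimensional
  have hbij := hB.bijective hσinv
  have hbij' := hB'.bijective hσinv
  choose f hf using fun x => hbij'.2 ((B x).comp g.symm.toLinearMap)
  have hf' : ∀ x y, B' (f x) (g y) = B x y := fun x y => by rw [hf]; simp
  let f₁ : V →ₗ[F] V' :=
    { toFun := f
      map_add' := fun x y => hbij'.1 (by ext z; simp [hf])
      map_smul' := fun c x => hbij'.1 (by ext z; simp [hf]) }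
  have hinj : Function.Injective f₁ := by
    rw [injective_iff_map_eq_zero]
    intro x hx
    apply hbij.1
    ext y
    rw [← hf', show f x = 0 from hx]
    simp
  let f₂ : V ≃ₗ[F] V' := LinearEquiv.ofBijective f₁
    ⟨hinj, (LinearMap.injective_iff_surjective_of_finrank_eq_finrank g.finrank_eq).1 hinj⟩
  refine Isom.of_weak hchar hσinv hσ f₂ g hf' fun x y => ?_
  change B' (g x) (f y) = B x y
  obtain ⟨x, rfl⟩ := φ.surjective x
  have h1 := hφ' (f y) (g x)
  rw [hf', ← hg] at h1
  have h2 := hφ y x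
  rw [h1] at h2
  exact σ.injective h2

end Duality

section Chain
variable {F : Type*} [Field F] {σ : F →+* F}
variable {V : Type*} [AddCommGroup V] [Module F V]

/-- a sequence of vectors which spans an orthogonal summand of type `J n 0` -/
structure IsChain (B : V →ₛₗ[σ] V →ₗ[F] F) (n : ℕ) (e : ℕ → V) : Prop where
  pos : 0 < n
  ne_zero : e 0 ≠ 0
  first : ∀ x, B (e 0) x = 0
  last : ∀ x, B x (e (n - 1)) = 0
  step : ∀ i, i + 2 < n → ∀ x, B (e (i + 2)) x = σ (B x (e i))
  val : ∀ i j, i + 1 < n → j < n → B (e (i + 1)) (e j) = if i = j then 1 else 0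

/-- the right radical -/
def rrad (B : V →ₛₗ[σ] V →ₗ[F] F) : Submodule F V where
  carrier := {y | ∀ x, B x y = 0}
  add_mem' := fun ha hb x => by simp [ha x, hb x]
  zero_mem' := by simp
  smul_mem' := fun c y hy x => by simp [hy x]

/-- the right orthogonal complement of a subspace -/
def rorth (B : V →ₛₗ[σ] V →ₗ[F] F) (S : Submodule F V) : Submodule F V where
  carrier := {y | ∀ x ∈ S, B x y = 0}
  add_mem' := fun ha hb x hx => by simp [ha x hx, hb x hx]
  zero_mem' := by simp
  smul_mem' := fun c y hy x hx => by simp [hy x hx]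

lemma IsChain.extend [FiniteDimensional F V] (hσinv : ∀ a, σ (σ a) = a)
    {B : V →ₛₗ[σ] V →ₗ[F] F} {M : Submodule F V} (hdisj : ∀ x ∈ rrad B, x ∈ M → x = 0)
    (hsup : rorth B (rrad B) = rrad B ⊔ M) {k : ℕ} {e : ℕ → M} (he : IsChain (restr B M) k e) :
    ∃ e', IsChain B (k + 2) e' := by
  have hM : ∀ m : M, ∀ r ∈ rrad B, B r m = 0 := fun m r hr => by
    have : (m : V) ∈ rorth B (rrad B) := by rw [hsup]; exact Submodule.mem_sup_right m.2
    exact this r hr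
  have hfun : ∀ f : V →ₗ[F] F, (∀ r ∈ rrad B, f r = 0) → (∀ m : M, f m = 0) →
      ∃ r ∈ rrad B, ∀ x, B r x = f x := by
    intro f hr hm
    refine exists_mem_form_eq hσinv B (rrad B) f fun x hx => ?_
    have : x ∈ rorth B (rrad B) := hx
    rw [hsup] at this
    obtain ⟨r, hr', m, hm', rfl⟩ := Submodule.mem_sup.1 this
    rw [map_add, hr r hr', hm ⟨m, hm'⟩, add_zero]
  have hpos := he.pos
  have hlast : ∀ x : M, B x (e (k - 1)) = 0 := he.last
  have hfirst : ∀ x : M, B (e 0) x = 0 := he.first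
  have hval : ∀ i j, i + 1 < k → j < k → B (e (i + 1)) (e j) = if i = j then 1 else 0 := he.val
  obtain ⟨r, hr, hr'⟩ := hfun (conjFun hσinv B (e (k - 1)))
    (fun r hr => by simp [hM _ r hr]) (fun m => by simp [hlast m])
  simp only [conjFun_apply] at hr'
  obtain ⟨n, hn1, hn2, hn3⟩ : ∃ n, (∀ j < k, B n (e j) = if j = k - 1 then 1 else 0) ∧ B n n = 0 ∧
      ∀ i, i + 2 = k → ∀ x, B n x = σ (B x (e i)) := by
    obtain rfl | ⟨k', rfl⟩ : k = 1 ∨ ∃ k', k = k' + 2 := by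
      rcases k with _ | _ | k'
      · omega
      · simp
      · exact Or.inr ⟨k', rfl⟩
    · obtain ⟨n₀, hn₀⟩ : ∃ n₀, B n₀ (e 0) = 1 := by
        have : ∃ x, B x (e 0) ≠ 0 := by
          by_contra! h
          exact he.ne_zero (Subtype.ext (hdisj _ h (e 0).2))
        obtain ⟨x, hx⟩ := this
        exact ⟨σ (B x (e 0))⁻¹ • x, by simp [hσinv, hx]⟩
      have h1 : B r n₀ = 1 := by rw [hr']; simp [hn₀]
      refine ⟨n₀ - σ (B n₀ n₀) • r, ?_, ?_, fun i hi => by omega⟩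
      · intro j hj
        obtain rfl : j = 0 := by omega
        simp [hn₀, hM _ r hr]
      · have h2 : ∀ x, B x r = 0 := hr
        simp [h1, h2, hσinv]
    · obtain ⟨n, -, hn⟩ := exists_mem_form_eq hσinv B ⊤ (conjFun hσinv B (e k')) (fun x hx => by
        have hx' : x ∈ rrad B := fun s => hx s trivial
        simp [hM _ x hx'])
      simp only [conjFun_apply] at hn
      have hn1 : ∀ j < k' + 2, B n (e j) = if j = k' + 1 then 1 else 0 := by
        intro j hj
        rw [hn]
        rcases j with _ | i
        · simp [hfirst]
        · rw [hval i k' hj (by omega)]; simp [apply_ite σ]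
      refine ⟨n, by simpa using hn1, ?_, ?_⟩
      · rw [hn, hn1 k' (by omega)]; simp
      · intro i hi; obtain rfl : i = k' := by omega
        exact hn
  have hrn : B r n = 1 := by rw [hr', hn1 _ (by omega)]; simp
  have hρ : ∀ j, ∃ ρ ∈ rrad B, j < k → (j = 0 → ∀ x, B (e 0 + ρ) x = 0) ∧
      (j = 1 → B (e 1 + ρ) n = 0) ∧ (∀ i, j = i + 2 → ∀ x, B (e j + ρ) x = σ (B x (e i))) := by
    intro j
    rcases j with _ | _ | i
    · obtain ⟨ρ, h, h'⟩ := hfun (-B (e 0)) (fun r hr => by simp [show B (e 0) r = 0 from hr _])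
        (fun m => by simp [hfirst m])
      exact ⟨ρ, h, fun _ => ⟨fun _ x => by simp [h'], by simp, by simp⟩⟩
    · refine ⟨-(σ (B (e 1) n)) • r, Submodule.smul_mem _ _ hr, fun _ => ⟨by simp, fun _ => ?_,
        by simp⟩⟩
      simp [hrn, hσinv]
    · by_cases hi : i + 2 < k
      · obtain ⟨ρ, h, h'⟩ := hfun (conjFun hσinv B (e i) - B (e (i + 2)))
          (fun r hr => by simp [hM _ r hr, show B (e (i + 2)) r = 0 from hr _])
          (fun m => by
            have : B (e (i + 2)) m = σ (B m (e i)) := he.step i hi m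
            simp [this])
        refine ⟨ρ, h, fun _ => ⟨by simp, by simp, fun i' hi' x => ?_⟩⟩
        obtain rfl : i = i' := by omega
        simp [h']
      · exact ⟨0, zero_mem _, fun h => absurd h hi⟩
  choose ρ hρ1 hρ2 using hρ
  have hR : ∀ j x, B x (ρ j) = 0 := fun j => hρ1 j
  have hr0 : ∀ x, B x r = 0 := hr
  refine ⟨fun j => if j < k then e j + ρ j else if j = k then n else r, ?_, ?_, ?_, ?_, ?_, ?_⟩
  · omega
  · simp only [hpos, if_true]
    intro h
    apply he.ne_zero
    apply Subtype.ext
    refine hdisj _ ?_ (e 0).2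
    rw [eq_neg_of_add_eq_zero_left h]
    exact Submodule.neg_mem _ (hρ1 0)
  · simpa only [hpos, if_true] using (hρ2 0 hpos).1 rfl
  · simpa using hr0
  · intro i hi x
    have hik : i < k := by omega
    rw [if_pos hik, map_add, hR, add_zero]
    rcases lt_trichotomy (i + 2) k with h | h | h
    · rw [if_pos h]
      exact (hρ2 _ h).2.2 i rfl x
    · rw [if_neg (by omega), if_pos h]
      exact hn3 i h x
    · rw [if_neg (by omega), if_neg (by omega)]
      obtain rfl : i = k - 1 := by omega
      exact hr' x
  · intro i j hi hj
    have h1 : ∀ j', j' < k → ∀ x : V, ∀ s : M, B (e j' + ρ j') (s + ρ j) = B (e j') s := by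
      intro j' _ x s
      simp [hR, hM s _ (hρ1 j')]
    rcases lt_trichotomy j k with hjk | hjk | hjk
    · rw [if_pos hjk]
      rcases lt_trichotomy (i + 1) k with h | h | h
      · rw [if_pos h, h1 _ h 0, hval i j h hjk]
      · rw [if_neg (by omega : ¬ i + 1 < k), if_pos h, map_add, hR, add_zero, hn1 j hjk]
        congr 1; exact propext (by omega)
      · rw [if_neg (by omega : ¬ i + 1 < k), if_neg (by omega : ¬ i + 1 = k), map_add, hR,
          add_zero, hM _ r hr, if_neg (by omega : ¬ i = j)]
    · rw [if_neg (by omega : ¬ j < k), if_pos hjk]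
      rcases lt_trichotomy (i + 1) k with h | h | h
      · rw [if_pos h, if_neg (by omega : ¬ i = j)]
        rcases i with _ | i
        · exact (hρ2 1 h).2.1 rfl
        · rw [(hρ2 _ h).2.2 i rfl, hn1 i (by omega), if_neg (by omega : ¬ i = k - 1), map_zero]
      · rw [if_neg (by omega : ¬ i + 1 < k), if_pos h, hn2, if_neg (by omega : ¬ i = j)]
      · rw [if_neg (by omega : ¬ i + 1 < k), if_neg (by omega : ¬ i + 1 = k), hrn,
          if_pos (by omega : i = j)]
    · rw [if_neg (by omega : ¬ j < k), if_neg (by omega : ¬ j = k), hr0,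
        if_neg (by omega : ¬ i = j)]

lemma exists_isChain [FiniteDimensional F V] (hσinv : ∀ a, σ (σ a) = a)
    (B : V →ₛₗ[σ] V →ₗ[F] F) (hB : ¬ RNondeg B) : ∃ n e, IsChain B n e := by
  induction hd : Module.finrank F V using Nat.strong_induction_on generalizing V with
  | _ d ih =>
  subst hd
  have hR : rrad B ≠ ⊥ := by
    intro h
    apply hB
    intro y hy
    have : y ∈ rrad B := hy
    simpa [h] using this
  obtain ⟨C, hC⟩ := exists_isCompl (rrad B)
  set L := rorth B (rrad B) with hL
  have hRL : rrad B ≤ L := fun y hy x _ => hy x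
  set M := C ⊓ L with hMdef
  have hdisj : ∀ x ∈ rrad B, x ∈ M → x = 0 := fun x hx hx' =>
    Submodule.disjoint_def.1 hC.disjoint x hx hx'.1
  have hsup : L = rrad B ⊔ M := by
    rw [hMdef, ← sup_inf_assoc_of_le C hRL, hC.sup_eq_top, top_inf_eq]
  by_cases hM : RNondeg (restr B M)
  · by_cases hr : ∃ r ∈ rrad B, ∃ x, B r x ≠ 0
    · obtain ⟨r, hr, x, hx⟩ := hr
      have hr0 : ∀ x, B x r = 0 := hr
      obtain ⟨m, -, hm⟩ := exists_mem_form_eq hσinv (restr B M) ⊤ ((B x).comp M.subtype)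
        (fun y hy => by rw [hM y fun s => hy s trivial, map_zero])
      obtain ⟨ρ, hρ, hρ'⟩ := exists_mem_form_eq hσinv B (rrad B) (B (m - x)) (fun y hy => by
        have hy' : y ∈ L := hy
        rw [hsup] at hy'
        obtain ⟨r', hr', m', hm', rfl⟩ := Submodule.mem_sup.1 hy'
        have h1 := hm ⟨m', hm'⟩
        have h2 : ∀ x, B x r' = 0 := hr'
        simp at h1
        simp [h1, h2])
      have hρ0 : ∀ x, B x ρ = 0 := hρ
      have hmL : B r m = 0 := m.2.2 r hr
      let e₁ := (B r x)⁻¹ • (x - m + ρ)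
      have he₁ : ∀ y, B e₁ y = 0 := fun y => by simp [e₁, hρ']; ring
      have hre₁ : B r e₁ = 1 := by simp [e₁, hmL, hρ0, hx]
      refine ⟨2, fun j => if j = 0 then e₁ else r, ?_, ?_, ?_, ?_, ?_, ?_⟩
      · norm_num
      · intro h
        simp only [if_true] at h
        rw [h] at hre₁
        simp at hre₁
      · simpa using he₁
      · simpa using hr0
      · intro i hi; omega
      · intro i j hi hj
        obtain rfl : i = 0 := by omega
        obtain rfl | rfl : j = 0 ∨ j = 1 := by omega
        · simpa using hre₁
        · simpa using hr0 r
    · push Not at hr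
      obtain ⟨r, hr', hr0⟩ := Submodule.exists_mem_ne_zero_of_ne_bot hR
      exact ⟨1, fun _ => r, one_pos, hr0, hr r hr', hr', fun i hi => by omega,
        fun i j hi => by omega⟩
  · have hlt : Module.finrank F M < Module.finrank F V := by
      apply Submodule.finrank_lt
      intro h
      apply hR
      rw [eq_bot_iff]
      intro x hx
      exact hdisj x hx (h ▸ trivial)
    obtain ⟨k, e, he⟩ := ih _ hlt (restr B M) hM rfl
    obtain ⟨e', he'⟩ := he.extend hσinv hdisj hsup
    exact ⟨_, e', he'⟩

end Chain

section MatForm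
variable {F : Type*} [Field F] {σ : F →+* F}
variable {V V' W W' : Type*} [AddCommGroup V] [Module F V] [AddCommGroup V'] [Module F V']
  [AddCommGroup W] [Module F W] [AddCommGroup W'] [Module F W']

lemma Isom.refl (B : V →ₛₗ[σ] V →ₗ[F] F) : Isom B B := ⟨LinearEquiv.refl F V, fun _ _ => rfl⟩

/-- the sesquilinear form with a given Gram matrix -/
def matForm (σ : F →+* F) {ι : Type*} [Fintype ι] (A : Matrix ι ι F) :
    (ι → F) →ₛₗ[σ] (ι → F) →ₗ[F] F :=
  LinearMap.mk₂'ₛₗ σ (RingHom.id F) (fun x y => (σ ∘ x) ⬝ᵥ (A *ᵥ y))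
    (fun x y z => by
      rw [show σ ∘ (x + y) = σ ∘ x + σ ∘ y by ext; simp, add_dotProduct])
    (fun c x z => by
      rw [show σ ∘ (c • x) = σ c • (σ ∘ x) by ext; simp, smul_dotProduct])
    (fun x y z => by rw [mulVec_add, dotProduct_add])
    (fun c x z => by simp [mulVec_smul, dotProduct_smul])

lemma matForm_apply {ι : Type*} [Fintype ι] (A : Matrix ι ι F) (x y : ι → F) :
    matForm σ A x y = (σ ∘ x) ⬝ᵥ (A *ᵥ y) := rfl

lemma matForm_single {ι : Type*} [Fintype ι] [DecidableEq ι] (A : Matrix ι ι F) (i j : ι) :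
    matForm σ A (Pi.single i 1) (Pi.single j 1) = A i j := by
  rw [matForm_apply, show σ ∘ (Pi.single i 1 : ι → F) = Pi.single i 1 by
    ext k; by_cases h : k = i
    · subst h; simp
    · simp [h]]
  simp

/-- two sesquilinear forms agreeing on a basis are equal -/
lemma form_ext_basis {ι : Type*} [Finite ι] (b : Module.Basis ι F V)
    {B B' : V →ₛₗ[σ] V →ₗ[F] F} (h : ∀ i j, B (b i) (b j) = B' (b i) (b j)) : B = B' :=
  b.ext fun i => b.ext fun j => h i j

/-- the orthogonal direct sum of two forms -/
def prodForm (B : V →ₛₗ[σ] V →ₗ[F] F) (B' : V' →ₛₗ[σ] V' →ₗ[F] F) :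
    (V × V') →ₛₗ[σ] (V × V') →ₗ[F] F :=
  (B.comp (LinearMap.fst F V V')).compl₂ (LinearMap.fst F V V') +
    (B'.comp (LinearMap.snd F V V')).compl₂ (LinearMap.snd F V V')

@[simp] lemma prodForm_apply (B : V →ₛₗ[σ] V →ₗ[F] F) (B' : V' →ₛₗ[σ] V' →ₗ[F] F)
    (x y : V × V') : prodForm B B' x y = B x.1 y.1 + B' x.2 y.2 := rfl

lemma Isom.prod {B : V →ₛₗ[σ] V →ₗ[F] F} {B' : V' →ₛₗ[σ] V' →ₗ[F] F}
    {C : W →ₛₗ[σ] W →ₗ[F] F} {C' : W' →ₛₗ[σ] W' →ₗ[F] F} (h : Isom B C) (h' : Isom B' C') :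
    Isom (prodForm B B') (prodForm C C') := by
  obtain ⟨f, hf⟩ := h
  obtain ⟨g, hg⟩ := h'
  exact ⟨f.prodCongr g, fun x y => by simp [hf, hg]⟩

lemma matForm_reindex_isom {ι κ : Type*} [Fintype ι] [Fintype κ] (e : ι ≃ κ) (A : Matrix ι ι F) :
    Isom (matForm σ (Matrix.reindex e e A)) (matForm σ A) := by
  refine ⟨LinearEquiv.funCongrLeft F F e, fun x y => ?_⟩
  simp only [matForm_apply, dotProduct, mulVec, Function.comp_apply, LinearEquiv.funCongrLeft_apply,
    LinearMap.funLeft_apply, reindex_apply, submatrix_apply]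
  rw [← e.sum_comp]
  refine Finset.sum_congr rfl fun i _ => ?_
  congr 1
  rw [← e.sum_comp]
  simp

lemma matForm_fromBlocks_isom {ι κ : Type*} [Fintype ι] [Fintype κ] (A : Matrix ι ι F)
    (D : Matrix κ κ F) :
    Isom (matForm σ (Matrix.fromBlocks A 0 0 D)) (prodForm (matForm σ A) (matForm σ D)) := by
  refine ⟨LinearEquiv.sumArrowLequivProdArrow ι κ F F, fun x y => ?_⟩
  simp only [matForm_apply, prodForm_apply, fromBlocks_mulVec, dotProduct, Fintype.sum_sum_type]
  simp [mulVec, dotProduct]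

lemma matForm_bsum_cons_isom (X : Block F) (L : List (Block F)) :
    Isom (matForm σ (bsum (X :: L)).2) (prodForm (matForm σ X.2) (matForm σ (bsum L).2)) :=
  (matForm_reindex_isom _ _).trans (matForm_fromBlocks_isom _ _)

lemma bStarCong_iff_isom (X Y : Block F) :
    BStarCong σ X Y ↔ Isom (matForm σ X.2) (matForm σ Y.2) := by
  obtain ⟨m, A⟩ := X
  obtain ⟨n, D⟩ := Y
  have key : ∀ {n : ℕ} (A D S : Mat F n) (x y : Fin n → F), ctr σ S * A * S = D →
      matForm σ D x y = matForm σ A (S *ᵥ x) (S *ᵥ y) := by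
    intro n A D S x y h
    subst h
    have : σ ∘ (S *ᵥ x) = (S.map σ) *ᵥ (σ ∘ x) := by
      ext i; simp [mulVec, dotProduct]
    rw [matForm_apply, matForm_apply, this, ctr, ← mulVec_mulVec, ← mulVec_mulVec,
      dotProduct_mulVec, vecMul_transpose]
  constructor
  · rintro ⟨h, S, hS, h'⟩
    dsimp at h
    subst h
    have : castMat rfl A = A := rfl
    rw [this] at h'
    refine Isom.symm ⟨S.toLinearEquiv' ((isUnit_iff_isUnit_det _).2 hS).invertible, fun x y => ?_⟩
    rw [key A D S x y h']
    rfl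
  · rintro ⟨f, hf⟩
    dsimp only at f hf
    have hmn : m = n := by simpa using f.finrank_eq
    subst hmn
    refine ⟨rfl, LinearMap.toMatrix' f.symm.toLinearMap, ?_, ?_⟩
    · simpa using LinearEquiv.isUnit_det' f.symm
    · change ctr σ _ * A * _ = D
      ext i j
      rw [← matForm_single (σ := σ) D, ← matForm_single (σ := σ) (_ * _),
        key A _ (LinearMap.toMatrix' f.symm.toLinearMap) (Pi.single i 1) (Pi.single j 1) rfl,
        ← f.apply_symm_apply (Pi.single i 1), ← f.apply_symm_apply (Pi.single j 1), hf]
      simp only [LinearMap.toMatrix'_mulVec, LinearEquiv.coe_coe, f.apply_symm_apply]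

end MatForm

section Splitting
variable {F : Type*} [Field F] {σ : F →+* F}
variable {V : Type*} [AddCommGroup V] [Module F V]

lemma IsChain.exists_isom (hσinv : ∀ a, σ (σ a) = a) {B : V →ₛₗ[σ] V →ₗ[F] F} {n : ℕ}
    {e : ℕ → V} (he : IsChain B n e) :
    ∃ U : Submodule F V, Isom B (prodForm (matForm σ (J F n 0)) (restr B U)) := by
  obtain ⟨hpos, hne, hfirst, hlast, hstep, hval⟩ := he
  obtain ⟨f₀, hf₀⟩ : ∃ f : V →ₗ[F] F, f (e 0) = 1 :=
    Module.Projective.exists_dual_eq_one F hne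
  let ξ : ℕ → V →ₗ[F] F := fun j =>
    if j + 1 < n then B (e (j + 1)) else if n = 1 then f₀ else conjFun hσinv B (e (n - 2))
  have hξ : ∀ i < n, ∀ j < n, ξ i (e j) = if i = j then 1 else 0 := by
    intro i hi j hj
    simp only [ξ]
    split_ifs with h1 h2 h3 h4 h5
    · rw [hval i j h1 hj, if_pos h2]
    · rw [hval i j h1 hj, if_neg h2]
    · obtain rfl : j = 0 := by omega
      exact hf₀
    · omega
    · subst h5
      obtain ⟨k, rfl⟩ : ∃ k, n = k + 2 := ⟨n - 2, by omega⟩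
      obtain rfl : i = k + 1 := by omega
      simp [hval k k]
    · obtain ⟨k, rfl⟩ : ∃ k, n = k + 2 := ⟨n - 2, by omega⟩
      rcases j with _ | j
      · simp [hfirst]
      · rw [conjFun_apply, hval j _ hj (by omega), if_neg (by omega), map_zero]
  have hleft : ∀ i, i + 1 < n → ∀ x, B (e (i + 1)) x = ξ i x := fun i hi x => by simp [ξ, hi]
  have hright : ∀ j, j + 1 < n → ∀ x, B x (e j) = σ (ξ (j + 1) x) := by
    intro j hj x
    simp only [ξ]
    split_ifs with h1 h2
    · rw [hstep j h1, hσinv]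
    · omega
    · obtain rfl : j = n - 2 := by omega
      simp [hσinv]
  let Ξ : V →ₗ[F] (Fin n → F) := LinearMap.pi fun i => ξ i
  let E : (Fin n → F) →ₗ[F] V := Fintype.linearCombination F fun i : Fin n => e i
  have hΞE : ∀ c, Ξ (E c) = c := by
    intro c
    ext i
    simp [Ξ, E, Fintype.linearCombination_apply, hξ, Fin.val_inj]
  let U := LinearMap.ker Ξ
  have hU : ∀ u : U, ∀ i < n, ξ i u = 0 := fun u i hi => congrFun (LinearMap.mem_ker.1 u.2) ⟨i, hi⟩
  have hUl : ∀ u : U, ∀ i < n, B (e i) u = 0 := by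
    intro u i hi
    rcases i with _ | i
    · exact hfirst u
    · rw [hleft i hi, hU u i (by omega)]
  have hUr : ∀ u : U, ∀ i < n, B u (e i) = 0 := by
    intro u i hi
    by_cases h : i + 1 < n
    · rw [hright i h, hU u _ h, map_zero]
    · obtain rfl : i = n - 1 := by omega
      exact hlast u
  let g : ((Fin n → F) × U) →ₗ[F] V := E.coprod U.subtype
  have hg : Function.Bijective g := by
    constructor
    · rw [injective_iff_map_eq_zero]
      rintro ⟨c, u⟩ h
      have h' : E c + u = 0 := by simpa [g] using h
      have hc : c = 0 := by
        have := congrArg Ξ h'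
        rwa [map_add, hΞE, LinearMap.mem_ker.1 u.2, add_zero, map_zero] at this
      subst hc
      have : u = 0 := by simpa using h'
      rw [this]; rfl
    · intro x
      refine ⟨(Ξ x, ⟨x - E (Ξ x), ?_⟩), by simp [g]⟩
      simp [U, hΞE]
  refine ⟨U, Isom.symm ⟨LinearEquiv.ofBijective g hg, fun x y => ?_⟩⟩
  obtain ⟨c, u⟩ := x
  obtain ⟨d, w⟩ := y
  have h1 : B (E c) w = 0 := by
    simp [E, Fintype.linearCombination_apply, hUl]
  have h2 : B u (E d) = 0 := by
    simp [E, Fintype.linearCombination_apply, hUr]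
  have h3 : (B.comp E).compl₂ E = matForm σ (J F n 0) := by
    refine form_ext_basis (Pi.basisFun F (Fin n)) fun i j => ?_
    rw [Pi.basisFun_apply, Pi.basisFun_apply, matForm_single]
    simp only [LinearMap.compl₂_apply, LinearMap.comp_apply, E,
      Fintype.linearCombination_apply_single, one_smul, J, Matrix.of_apply]
    obtain ⟨i, hi⟩ := i
    obtain ⟨j, hj⟩ := j
    rcases i with _ | i
    · simp [hfirst]
    · simp only [hval i j hi hj]
      by_cases h : i = j <;> simp [h]
  have h4 := LinearMap.congr_fun (LinearMap.congr_fun h3 c) d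
  simp only [LinearMap.compl₂_apply, LinearMap.comp_apply] at h4
  simp [g, h1, h2, h4]

end Splitting

section
universe u
variable {F : Type u} [Field F] {σ : F →+* F}

/-- Splitting off the degenerate part: it suffices to decompose nondegenerate forms. -/
lemma exists_isom_bsum (hσinv : ∀ a, σ (σ a) = a) (P : Block F → Prop)
    (hP : ∀ n, 0 < n → P ⟨n, J F n 0⟩)
    (hnd : ∀ (V : Type u) [AddCommGroup V] [Module F V] [FiniteDimensional F V]
      (B : V →ₛₗ[σ] V →ₗ[F] F), RNondeg B →
      ∃ L : List (Block F), (∀ b ∈ L, P b) ∧ Isom B (matForm σ (bsum L).2))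
    (V : Type u) [AddCommGroup V] [Module F V] [FiniteDimensional F V]
    (B : V →ₛₗ[σ] V →ₗ[F] F) :
    ∃ L : List (Block F), (∀ b ∈ L, P b) ∧ Isom B (matForm σ (bsum L).2) := by
  induction hd : Module.finrank F V using Nat.strong_induction_on generalizing V with
  | _ d ih =>
  by_cases hB : RNondeg B
  · exact hnd V B hB
  obtain ⟨n, e, he⟩ := exists_isChain hσinv B hB
  obtain ⟨U, hU⟩ := he.exists_isom hσinv
  have hlt : Module.finrank F U < d := by
    obtain ⟨f, -⟩ := hU
    have h1 := f.finrank_eq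
    have h2 := he.pos
    rw [Module.finrank_prod, Module.finrank_fin_fun] at h1
    omega
  obtain ⟨L, hL, hL'⟩ := ih _ hlt U (restr B U) rfl
  refine ⟨⟨n, J F n 0⟩ :: L, by simpa using ⟨hP n he.pos, hL⟩, ?_⟩
  exact hU.trans (((Isom.refl _).prod hL').trans (matForm_bsum_cons_isom ⟨n, J F n 0⟩ L).symm)

end

section Invariants
variable {F : Type*} [Field F] {σ : F →+* F}
variable {V V' : Type*} [AddCommGroup V] [Module F V] [AddCommGroup V'] [Module F V']

/-- the graph of the asymmetry (cosquare) of a form, as a relation -/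
def cosqRel (B : V →ₛₗ[σ] V →ₗ[F] F) (x y : V) : Prop := ∀ t, B t x = σ (B y t)

/-- vectors from which zero is reached in `i` steps along the asymmetry relation -/
def nilSet (B : V →ₛₗ[σ] V →ₗ[F] F) : ℕ → Set V
  | 0 => {0}
  | i + 1 => {x | ∃ y ∈ nilSet B i, cosqRel B x y}

/-- the part of `nilSet` in the left radical -/
def nilRadSet (B : V →ₛₗ[σ] V →ₗ[F] F) (i : ℕ) : Set V := {x | x ∈ nilSet B i ∧ ∀ t, B x t = 0}

/-- trajectories of the asymmetry relation annihilated by a polynomial -/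
def trajSet (B : V →ₛₗ[σ] V →ₗ[F] F) (q : F[X]) : Set (ℕ → V) :=
  {z | (∀ i < q.natDegree, cosqRel B (z i) (z (i + 1))) ∧ (∀ i, q.natDegree < i → z i = 0) ∧
    ∑ i ∈ Finset.range (q.natDegree + 1), q.coeff i • z i = 0}

section Isom
variable {B : V →ₛₗ[σ] V →ₗ[F] F} {B' : V' →ₛₗ[σ] V' →ₗ[F] F} {f : V ≃ₗ[F] V'}

lemma cosqRel_map (hf : ∀ x y, B' (f x) (f y) = B x y) (x y : V) :
    cosqRel B' (f x) (f y) ↔ cosqRel B x y := by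
  simp only [cosqRel, ← hf]
  exact f.surjective.forall

lemma nilSet_map (hf : ∀ x y, B' (f x) (f y) = B x y) (i : ℕ) (x : V) :
    f x ∈ nilSet B' i ↔ x ∈ nilSet B i := by
  induction i generalizing x with
  | zero => simp [nilSet]
  | succ i ih =>
    simp only [nilSet, Set.mem_ofPred_eq]
    rw [f.surjective.exists]
    simp [ih, cosqRel_map hf]

lemma nilRadSet_map (hf : ∀ x y, B' (f x) (f y) = B x y) (i : ℕ) (x : V) :
    f x ∈ nilRadSet B' i ↔ x ∈ nilRadSet B i := by
  simp only [nilRadSet, Set.mem_ofPred_eq, nilSet_map hf]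
  rw [f.surjective.forall]
  simp [hf]

lemma trajSet_map (hf : ∀ x y, B' (f x) (f y) = B x y) (q : F[X]) (z : ℕ → V) :
    (fun i => f (z i)) ∈ trajSet B' q ↔ z ∈ trajSet B q := by
  simp only [trajSet, Set.mem_ofPred_eq, cosqRel_map hf, ← map_smul, ← map_sum,
    LinearEquiv.map_eq_zero_iff]

end Isom

lemma Isom.card_nilSet {B : V →ₛₗ[σ] V →ₗ[F] F} {B' : V' →ₛₗ[σ] V' →ₗ[F] F} (h : Isom B B')
    (i : ℕ) : Nat.card (nilSet B i) = Nat.card (nilSet B' i) := by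
  obtain ⟨f, hf⟩ := h
  exact Nat.card_congr (f.toEquiv.subtypeEquiv fun x => (nilSet_map hf i x).symm)

lemma Isom.card_nilRadSet {B : V →ₛₗ[σ] V →ₗ[F] F} {B' : V' →ₛₗ[σ] V' →ₗ[F] F} (h : Isom B B')
    (i : ℕ) : Nat.card (nilRadSet B i) = Nat.card (nilRadSet B' i) := by
  obtain ⟨f, hf⟩ := h
  exact Nat.card_congr (f.toEquiv.subtypeEquiv fun x => (nilRadSet_map hf i x).symm)

lemma Isom.card_trajSet {B : V →ₛₗ[σ] V →ₗ[F] F} {B' : V' →ₛₗ[σ] V' →ₗ[F] F} (h : Isom B B')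
    (q : F[X]) : Nat.card (trajSet B q) = Nat.card (trajSet B' q) := by
  obtain ⟨f, hf⟩ := h
  exact Nat.card_congr ((Equiv.piCongrRight fun _ : ℕ => f.toEquiv).subtypeEquiv
    fun z => (trajSet_map hf q z).symm)

variable (B : V →ₛₗ[σ] V →ₗ[F] F) (B' : V' →ₛₗ[σ] V' →ₗ[F] F)

lemma cosqRel_prodForm (x y : V × V') :
    cosqRel (prodForm B B') x y ↔ cosqRel B x.1 y.1 ∧ cosqRel B' x.2 y.2 := by
  constructor
  · intro h
    exact ⟨fun t => by simpa using h (t, 0), fun t => by simpa using h (0, t)⟩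
  · rintro ⟨h, h'⟩ t
    simp [h t.1, h' t.2]

lemma nilSet_prodForm (i : ℕ) (x : V × V') :
    x ∈ nilSet (prodForm B B') i ↔ x.1 ∈ nilSet B i ∧ x.2 ∈ nilSet B' i := by
  induction i generalizing x with
  | zero => simp [nilSet, Prod.ext_iff]
  | succ i ih =>
    simp only [nilSet, Set.mem_ofPred_eq, cosqRel_prodForm, ih]
    constructor
    · rintro ⟨y, ⟨h1, h2⟩, h3, h4⟩
      exact ⟨⟨y.1, h1, h3⟩, y.2, h2, h4⟩
    · rintro ⟨⟨y, h1, h3⟩, y', h2, h4⟩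
      exact ⟨(y, y'), ⟨h1, h2⟩, h3, h4⟩

lemma nilRadSet_prodForm (i : ℕ) (x : V × V') :
    x ∈ nilRadSet (prodForm B B') i ↔ x.1 ∈ nilRadSet B i ∧ x.2 ∈ nilRadSet B' i := by
  simp only [nilRadSet, Set.mem_ofPred_eq, nilSet_prodForm]
  have : (∀ t, prodForm B B' x t = 0) ↔ (∀ t, B x.1 t = 0) ∧ ∀ t, B' x.2 t = 0 := by
    constructor
    · intro h
      exact ⟨fun t => by simpa using h (t, 0), fun t => by simpa using h (0, t)⟩
    · rintro ⟨h, h'⟩ t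
      simp [h t.1, h' t.2]
  rw [this]
  tauto

lemma trajSet_prodForm (q : F[X]) (z : ℕ → V × V') :
    z ∈ trajSet (prodForm B B') q ↔
      (fun i => (z i).1) ∈ trajSet B q ∧ (fun i => (z i).2) ∈ trajSet B' q := by
  simp only [trajSet, Set.mem_ofPred_eq, cosqRel_prodForm, Prod.ext_iff, Prod.fst_sum,
    Prod.snd_sum, Prod.smul_fst, Prod.smul_snd, Prod.fst_zero, Prod.snd_zero, forall_and]
  tauto

lemma card_nilSet_prodForm (i : ℕ) :
    Nat.card (nilSet (prodForm B B') i) = Nat.card (nilSet B i) * Nat.card (nilSet B' i) := by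
  rw [← Nat.card_prod]
  exact Nat.card_congr ((Equiv.subtypeEquivRight (nilSet_prodForm B B' i)).trans
    Equiv.subtypeProdEquivProd)

lemma card_nilRadSet_prodForm (i : ℕ) : Nat.card (nilRadSet (prodForm B B') i) =
    Nat.card (nilRadSet B i) * Nat.card (nilRadSet B' i) := by
  rw [← Nat.card_prod]
  exact Nat.card_congr ((Equiv.subtypeEquivRight (nilRadSet_prodForm B B' i)).trans
    Equiv.subtypeProdEquivProd)

lemma card_trajSet_prodForm (q : F[X]) : Nat.card (trajSet (prodForm B B') q) =
    Nat.card (trajSet B q) * Nat.card (trajSet B' q) := by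
  rw [← Nat.card_prod]
  exact Nat.card_congr (((Equiv.arrowProdEquivProdArrow ℕ (fun _ => V) fun _ => V').subtypeEquiv
    (trajSet_prodForm B B' q)).trans Equiv.subtypeProdEquivProd)

variable {B B'}

lemma cosqRel_iff (hB : RNondeg B) {φ : V ≃ₗ[F] V} (hφ : ∀ x y, B x y = σ (B (φ y) x))
    (x y : V) : cosqRel B x y ↔ y = φ x := by
  constructor
  · intro h
    rw [← sub_eq_zero, ← φ.apply_symm_apply (y - φ x)]
    have h0 : ∀ t, B (y - φ x) t = 0 := fun t => σ.injective (by
      rw [map_sub, LinearMap.sub_apply, map_sub, ← h t, ← hφ, sub_self, map_zero])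
    have h1 : φ.symm (y - φ x) = 0 := hB _ fun t => by rw [hφ, φ.apply_symm_apply, h0, map_zero]
    rw [h1, map_zero]
  · rintro rfl t
    exact hφ t x

lemma nilSet_eq_of_cosquare (hB : RNondeg B) {φ : V ≃ₗ[F] V}
    (hφ : ∀ x y, B x y = σ (B (φ y) x)) (i : ℕ) : nilSet B i = {0} := by
  induction i with
  | zero => rfl
  | succ i ih =>
    ext x
    simp [nilSet, ih, cosqRel_iff hB hφ, eq_comm (a := (0 : V))]

lemma card_nilSet_of_cosquare (hB : RNondeg B) {φ : V ≃ₗ[F] V}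
    (hφ : ∀ x y, B x y = σ (B (φ y) x)) (i : ℕ) : Nat.card (nilSet B i) = 1 := by
  rw [nilSet_eq_of_cosquare hB hφ]; simp

lemma card_nilRadSet_of_cosquare (hB : RNondeg B) {φ : V ≃ₗ[F] V}
    (hφ : ∀ x y, B x y = σ (B (φ y) x)) (i : ℕ) : Nat.card (nilRadSet B i) = 1 := by
  have : nilRadSet B i = {0} := by
    ext x
    simp only [nilRadSet, nilSet_eq_of_cosquare hB hφ, Set.mem_ofPred_eq, Set.mem_singleton_iff]
    exact ⟨fun h => h.1, by rintro rfl; simp⟩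
  rw [this]; simp

lemma card_trajSet_of_cosquare (hB : RNondeg B) {φ : V ≃ₗ[F] V}
    (hφ : ∀ x y, B x y = σ (B (φ y) x)) (q : F[X]) :
    Nat.card (trajSet B q) = Nat.card (LinearMap.ker (aeval φ.toLinearMap q)) := by
  let g (x : V) (i : ℕ) : V := if i ≤ q.natDegree then (φ.toLinearMap ^ i) x else 0
  have hg : ∀ x, ∑ i ∈ Finset.range (q.natDegree + 1), q.coeff i • g x i =
      aeval φ.toLinearMap q x := by
    intro x
    rw [aeval_eq_sum_range, LinearMap.sum_apply]
    refine Finset.sum_congr rfl fun i hi => ?_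
    simp [g, Nat.lt_succ_iff.1 (Finset.mem_range.1 hi)]
  have hz : ∀ z ∈ trajSet B q, g (z 0) = z := by
    rintro z ⟨h1, h2, -⟩
    ext i
    by_cases hi : i ≤ q.natDegree
    · simp only [g, if_pos hi]
      induction i with
      | zero => rfl
      | succ i ih =>
        rw [(cosqRel_iff hB hφ _ _).1 (h1 i hi), ← ih (by omega), pow_succ']
        rfl
    · simp [g, hi, h2 i (by omega)]
  have hmem : ∀ x : LinearMap.ker (aeval φ.toLinearMap q), g x ∈ trajSet B q := by
    refine fun x => ⟨fun i hi => ?_, fun i hi => if_neg (by omega), (hg x).trans x.2⟩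
    rw [cosqRel_iff hB hφ]
    simp only [g, if_pos hi.le, if_pos (Nat.succ_le_of_lt hi), pow_succ']
    rfl
  refine (Nat.card_congr (Equiv.ofBijective (
    fun x : LinearMap.ker (aeval φ.toLinearMap q) => (⟨g x, hmem x⟩ : trajSet B q)) ⟨?_, ?_⟩)).symm
  · intro x y h
    have := congrFun (congrArg Subtype.val h) 0
    exact Subtype.ext (by simpa [g] using this)
  · rintro ⟨z, hz'⟩
    refine ⟨⟨z 0, ?_⟩, Subtype.ext (hz z hz')⟩
    rw [LinearMap.mem_ker, ← hg, hz z hz']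
    exact hz'.2.2

lemma card_trajSet_pos [Finite V] (q : F[X]) : 0 < Nat.card (trajSet B q) := by
  have h0 : (0 : ℕ → V) ∈ trajSet B q := by simp [trajSet, cosqRel]
  have : Nonempty (trajSet B q) := ⟨⟨0, h0⟩⟩
  have : Finite (trajSet B q) := by
    refine Finite.of_injective
      (fun z : trajSet B q => fun i : Fin (q.natDegree + 1) => (z : ℕ → V) i) fun z w h => ?_
    ext i
    by_cases hi : i < q.natDegree + 1
    · exact congrFun h ⟨i, hi⟩
    · rw [z.2.2.1 i (by omega), w.2.2.1 i (by omega)]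
  exact Nat.card_pos

end Invariants

section JordanInvariants
variable {F : Type*} [Field F] {σ : F →+* F}

lemma matForm_J_apply (n : ℕ) (x y : ℕ → F) :
    matForm σ (J F n 0) (fun i => x i) (fun i => y i) =
      ∑ i ∈ Finset.range (n - 1), σ (x (i + 1)) * y i := by
  rcases n with _ | n
  · simp [matForm_apply]
  · simp only [matForm_apply, dotProduct, Function.comp_apply, mulVec, J, Matrix.of_apply]
    rw [Fin.sum_univ_succ, Finset.sum_range]
    have h0 : ∀ j : Fin (n + 1),
        (if (0 : Fin (n + 1)) = j then (0 : F) else if ((0 : Fin (n + 1)) : ℕ) = j + 1 then 1 else 0)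
          = 0 := by intro j; simp
    simp only [h0, zero_mul, Finset.sum_const_zero, mul_zero, zero_add]
    refine Finset.sum_congr rfl fun i _ => ?_
    rw [Finset.sum_eq_single i.castSucc]
    · simp [Fin.ext_iff]
    · intro j _ hj
      have : ¬ (i : ℕ) = j := fun h => hj (Fin.ext h.symm)
      simp [this]
    · simp

/-- extension of a vector by zero -/
def extZero {n : ℕ} (x : Fin n → F) (k : ℕ) : F := if h : k < n then x ⟨k, h⟩ else 0

lemma extZero_val {n : ℕ} (x : Fin n → F) : (fun i : Fin n => extZero x i) = x := by
  ext i; simp [extZero]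

lemma extZero_of_le {n : ℕ} (x : Fin n → F) {k : ℕ} (h : n ≤ k) : extZero x k = 0 := by
  simp [extZero, h]

lemma matForm_J (n : ℕ) (x y : Fin n → F) : matForm σ (J F n 0) x y =
    ∑ i ∈ Finset.range (n - 1), σ (extZero x (i + 1)) * extZero y i := by
  rw [← matForm_J_apply, extZero_val, extZero_val]

lemma extZero_single {n : ℕ} (k : Fin n) (i : ℕ) :
    extZero (Pi.single k (1 : F)) i = if i = k then 1 else 0 := by
  by_cases h : i < n
  · simp [extZero, h, Pi.single_apply, Fin.ext_iff]
  · simp [extZero, h, show i ≠ k by have := k.2; omega]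

lemma forall_matForm_J_left (n : ℕ) (x : Fin n → F) :
    (∀ t, matForm σ (J F n 0) x t = 0) ↔ ∀ k : Fin n, (k : ℕ) ≠ 0 → x k = 0 := by
  constructor
  · intro h k hk
    obtain ⟨k, hk'⟩ := k
    rcases k with _ | k
    · simp at hk
    · have := h (Pi.single ⟨k, by omega⟩ 1)
      rw [matForm_J] at this
      simp only [extZero_single, mul_ite, mul_one, mul_zero, Finset.sum_ite_eq',
        Finset.mem_range, if_pos (show k < n - 1 by omega), map_eq_zero] at this
      simpa [extZero, hk'] using this
  · intro h t
    rw [matForm_J]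
    refine Finset.sum_eq_zero fun i hi => ?_
    have hi' : i + 1 < n := by have := Finset.mem_range.1 hi; omega
    simp [extZero, hi', h ⟨i + 1, hi'⟩]

lemma cosqRel_J (hσinv : ∀ a, σ (σ a) = a) (n : ℕ) (x y : Fin n → F) :
    cosqRel (matForm σ (J F n 0)) x y ↔
      (1 < n → extZero y 1 = 0) ∧ ∀ k, k + 1 < n → extZero x k = extZero y (k + 2) := by
  have key : ∀ t : Fin n → F, σ (matForm σ (J F n 0) y t) =
      ∑ i ∈ Finset.range (n - 1), σ (extZero t i) * extZero y (i + 1) := by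
    intro t
    rw [matForm_J, map_sum]
    simp [hσinv, mul_comm]
  simp only [cosqRel, key]
  simp only [matForm_J]
  constructor
  · intro h
    constructor
    · intro hn
      have := h (Pi.single ⟨0, by omega⟩ 1)
      simpa [extZero_single, hn, apply_ite σ] using this.symm
    · intro k hk
      have := h (Pi.single ⟨k + 1, hk⟩ 1)
      simp only [extZero_single, apply_ite σ, map_one, map_zero, ite_mul, one_mul, zero_mul,
        add_left_inj, Finset.sum_ite_eq', Finset.mem_range,
        if_pos (show k < n - 1 by omega)] at this
      rw [this]
      split_ifs with h'
      · rfl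
      · rw [extZero_of_le]; omega
  · rintro ⟨h1, h2⟩ t
    rcases n with _ | _ | n
    · simp
    · simp
    · simp only [show n + 1 + 1 - 1 = n + 1 from rfl]
      rw [Finset.sum_range_succ, Finset.sum_range_succ' (fun i => σ (extZero t i) * _)]
      rw [h2 n (by omega), extZero_of_le y le_rfl, h1 (by omega)]
      simp only [mul_zero, add_zero]
      exact Finset.sum_congr rfl fun i hi => by
        rw [h2 i (by have := Finset.mem_range.1 hi; omega)]

lemma mem_nilSet_J (hσinv : ∀ a, σ (σ a) = a) (n i : ℕ) (x : Fin n → F) :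
    x ∈ nilSet (matForm σ (J F n 0)) i ↔
      ∀ k : Fin n, (¬ ∃ a < i, (k : ℕ) + 2 * a + 1 = n) → x k = 0 := by
  induction i generalizing x with
  | zero => simp [nilSet, funext_iff]
  | succ i ih =>
    simp only [nilSet, Set.mem_ofPred_eq, ih, cosqRel_J hσinv]
    constructor
    · rintro ⟨y, hy, h1, h2⟩ k hk
      by_cases hk' : (k : ℕ) + 1 < n
      · have := h2 k hk'
        simp only [extZero, k.2, dif_pos] at this
        rw [this]
        split_ifs with h
        · refine hy _ fun ⟨a, ha, ha'⟩ => hk ⟨a + 1, by omega, ?_⟩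
          simp only at ha'
          omega
        · rfl
      · exact absurd ⟨0, by omega, by omega⟩ hk
    · intro h
      refine ⟨fun j => if 2 ≤ (j : ℕ) then extZero x (j - 2) else 0, ?_, ?_, ?_⟩
      · intro k hk
        simp only
        split_ifs with h2
        · have : (k : ℕ) - 2 < n := by omega
          simp only [extZero, this, dif_pos]
          refine h _ ?_
          rintro ⟨a, ha, ha'⟩
          simp only at ha'
          rcases a with _ | a
          · omega
          · exact hk ⟨a, by omega, by omega⟩
        · rfl
      · intro hn; simp [extZero]
      · intro k hk
        by_cases hk2 : k + 2 < n
        · simp [extZero, hk2]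
        · rw [extZero_of_le _ (by omega : n ≤ k + 2)]
          simp only [extZero, show k < n by omega, dif_pos]
          refine h _ ?_
          rintro ⟨a, ha, ha'⟩
          simp only at ha'
          omega

lemma natCard_supported [Finite F] {ι : Type*} [Fintype ι] (p : ι → Prop) [DecidablePred p] :
    Nat.card {x : ι → F // ∀ k, ¬ p k → x k = 0} = Nat.card F ^ (Finset.univ.filter p).card := by
  rw [← Fintype.card_subtype, ← Nat.card_eq_fintype_card, ← Nat.card_fun]
  refine Nat.card_congr
    { toFun := fun x k => x.1 k
      invFun := fun x => ⟨fun k => if h : p k then x ⟨k, h⟩ else 0, fun k hk => dif_neg hk⟩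
      left_inv := fun x => ?_
      right_inv := fun x => ?_ }
  · ext k
    by_cases h : p k
    · simp [h]
    · simp [h, x.2 k h]
  · ext k
    simp [k.2]

lemma card_nilSet_J [Finite F] (hσinv : ∀ a, σ (σ a) = a) (n i : ℕ) :
    Nat.card (nilSet (matForm σ (J F n 0)) i) = Nat.card F ^ min i ((n + 1) / 2) := by
  classical
  rw [Nat.card_congr (Equiv.subtypeEquivRight (mem_nilSet_J hσinv n i)), natCard_supported]
  congr 1
  rw [← Finset.card_range (min i ((n + 1) / 2))]
  refine Finset.card_bij' (fun k _ => (n - 1 - (k : ℕ)) / 2)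
    (fun a ha => ⟨n - 1 - 2 * a, by have := Finset.mem_range.1 ha; omega⟩) ?_ ?_ ?_ ?_
  · intro k hk
    simp only [Finset.mem_filter, Finset.mem_univ, true_and] at hk
    obtain ⟨a, ha, ha'⟩ := hk
    rw [Finset.mem_range]
    omega
  · intro a ha
    rw [Finset.mem_range] at ha
    simp only [Finset.mem_filter, Finset.mem_univ, true_and]
    exact ⟨a, by omega, by omega⟩
  · intro k hk
    simp only [Finset.mem_filter, Finset.mem_univ, true_and] at hk
    obtain ⟨a, ha, ha'⟩ := hk
    ext
    simp only
    omega
  · intro a ha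
    rw [Finset.mem_range] at ha
    simp only
    omega

lemma card_nilRadSet_J [Finite F] (hσinv : ∀ a, σ (σ a) = a) (n i : ℕ) :
    Nat.card (nilRadSet (matForm σ (J F n 0)) i) =
      Nat.card F ^ (if n % 2 = 1 ∧ n < 2 * i then 1 else 0) := by
  classical
  have : ∀ x, x ∈ nilRadSet (matForm σ (J F n 0)) i ↔
      ∀ k : Fin n, (¬ ((k : ℕ) = 0 ∧ n % 2 = 1 ∧ n < 2 * i)) → x k = 0 := by
    intro x
    simp only [nilRadSet, Set.mem_ofPred_eq, mem_nilSet_J hσinv, forall_matForm_J_left]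
    constructor
    · rintro ⟨h1, h2⟩ k hk
      by_cases hk0 : (k : ℕ) = 0
      · exact h1 k fun ⟨a, ha, ha'⟩ => hk ⟨hk0, by omega, by omega⟩
      · exact h2 k hk0
    · intro h
      refine ⟨fun k hk => h k ?_, fun k hk => h k fun h' => hk h'.1⟩
      rintro ⟨h1, h2, h3⟩
      exact hk ⟨(n - 1) / 2, by omega, by omega⟩
  rw [Nat.card_congr (Equiv.subtypeEquivRight this), natCard_supported]
  congr 1
  split_ifs with h
  · rw [Finset.card_eq_one]
    refine ⟨⟨0, by omega⟩, ?_⟩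
    ext k
    simp [h, Fin.ext_iff]
  · rw [Finset.card_eq_zero]
    ext k
    simp only [Finset.mem_filter, Finset.mem_univ, true_and, Finset.notMem_empty, iff_false]
    tauto

end JordanInvariants

section ElementaryDivisors
universe u
variable {F : Type u} [Field F]

open scoped Classical in
/-- the contribution of a multiset of prime powers to the kernel of `p ^ k` -/
def kerWeight (s : Multiset (F[X] × ℕ)) (p : F[X]) (k : ℕ) : ℕ :=
  (s.map fun x => if x.1 = p then min k x.2 else 0).sum

/-- multisets of proper powers of monic irreducible polynomials -/
def IsPrimePowers (s : Multiset (F[X] × ℕ)) : Prop :=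
  ∀ x ∈ s, x.1.Monic ∧ Irreducible x.1 ∧ 0 < x.2

lemma kerWeight_add (s t : Multiset (F[X] × ℕ)) (p : F[X]) (k : ℕ) :
    kerWeight (s + t) p k = kerWeight s p k + kerWeight t p k := by simp [kerWeight]

open scoped Classical in
lemma count_add_kerWeight (s : Multiset (F[X] × ℕ)) (p : F[X]) (k : ℕ) :
    s.count (p, k + 1) + kerWeight s p k + kerWeight s p (k + 2) = 2 * kerWeight s p (k + 1) := by
  induction s using Multiset.induction_on with
  | empty => simp [kerWeight]
  | cons a s ih =>
    obtain ⟨r, e⟩ := a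
    simp only [kerWeight, Multiset.map_cons, Multiset.sum_cons, Multiset.count_cons] at ih ⊢
    by_cases h : r = p
    · subst h
      simp only [if_true, Prod.mk.injEq, true_and]
      split_ifs <;> omega
    · have h' : ¬ (p, k + 1) = (r, e) := fun h' => h (congrArg Prod.fst h').symm
      simp only [h, h', if_false]
      omega

lemma IsPrimePowers.eq_of_kerWeight {s t : Multiset (F[X] × ℕ)} (hs : IsPrimePowers s)
    (ht : IsPrimePowers t) (h : ∀ p : F[X], p.Monic → Irreducible p → ∀ k,
      kerWeight s p k = kerWeight t p k) : s = t := by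
  classical
  ext ⟨p, e⟩
  by_cases hp : p.Monic ∧ Irreducible p ∧ 0 < e
  · obtain ⟨hm, hi, he⟩ := hp
    obtain ⟨k, rfl⟩ : ∃ k, e = k + 1 := ⟨e - 1, by omega⟩
    have h1 := count_add_kerWeight s p k
    have h2 := count_add_kerWeight t p k
    rw [h p hm hi, h p hm hi, h p hm hi] at h1
    omega
  · rw [Multiset.count_eq_zero_of_notMem fun h' => hp (hs _ h'),
      Multiset.count_eq_zero_of_notMem fun h' => hp (ht _ h')]

/-- the cyclic module with annihilator generated by a power of a polynomial -/
abbrev CycMod (x : F[X] × ℕ) : Type u := F[X] ⧸ Ideal.span {x.1 ^ x.2}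

lemma pow_smul_cycMod (x : F[X] × ℕ) (y : CycMod x) : x.1 ^ x.2 • y = 0 := by
  obtain ⟨y, rfl⟩ := Ideal.Quotient.mk_surjective y
  rw [← Ideal.Quotient.mk_eq_mk, ← Submodule.Quotient.mk_smul, Submodule.Quotient.mk_eq_zero]
  exact Ideal.mul_mem_right _ _ (Ideal.mem_span_singleton_self _)

lemma natCard_cycMod [Finite F] {x : F[X] × ℕ} (hx : x.1.Monic) :
    Nat.card (CycMod x) = Nat.card F ^ (x.1.natDegree * x.2) := by
  have : Module.Finite F (CycMod x) := (hx.pow x.2).finite_quotient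
  rw [Module.natCard_eq_pow_finrank (K := F), finrank_quotient_span_eq_natDegree, natDegree_pow,
    mul_comm]

open scoped Classical in
lemma natCard_ker_cycMod [Finite F] {x : F[X] × ℕ} (hx : x.1.Monic) (hx' : Irreducible x.1)
    {p : F[X]} (hp : p.Monic) (hp' : Irreducible p) (k : ℕ) :
    Nat.card {y : CycMod x // p ^ k • y = 0} =
      Nat.card F ^ (p.natDegree * if x.1 = p then min k x.2 else 0) := by
  obtain ⟨r, e⟩ := x
  dsimp only at hx hx'
  split_ifs with h
  · dsimp only at h
    subst h
    rcases le_total e k with hke | hke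
    · rw [min_eq_right hke, ← natCard_cycMod (x := (r, e)) hx]
      refine Nat.card_congr (Equiv.subtypeUnivEquiv fun y => ?_)
      obtain ⟨c, rfl⟩ := Nat.exists_eq_add_of_le hke
      rw [add_comm, pow_add, mul_smul, pow_smul_cycMod (r, e), smul_zero]
    · rw [min_eq_left hke, ← natCard_cycMod (x := (r, k)) hx]
      obtain ⟨c, rfl⟩ := Nat.exists_eq_add_of_le hke
      have hne : ∀ m, r ^ m ≠ 0 := fun m => pow_ne_zero _ hx.ne_zero
      let g : CycMod (r, k) →ₗ[F[X]] CycMod (r, k + c) :=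
        Submodule.mapQ _ _ (LinearMap.mulLeft F[X] (r ^ c)) (by
          intro y hy
          rw [Ideal.mem_span_singleton] at hy
          rw [Submodule.mem_comap, Ideal.mem_span_singleton, LinearMap.mulLeft_apply, pow_add,
            mul_comm]
          exact mul_dvd_mul_left _ hy)
      have hg : ∀ y : F[X], g (Submodule.Quotient.mk y) = Submodule.Quotient.mk (r ^ c * y) :=
        fun y => rfl
      refine (Nat.card_congr (Equiv.ofBijective (fun y : CycMod (r, k) =>
        (⟨g y, by rw [← map_smul, pow_smul_cycMod (r, k), map_zero]⟩ :
          {y : CycMod (r, k + c) // r ^ k • y = 0})) ⟨?_, ?_⟩)).symm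
      · intro y z hyz
        have hyz' : g y = g z := congrArg Subtype.val hyz
        revert hyz'
        clear hyz
        rw [← sub_eq_zero, ← map_sub, ← sub_eq_zero (a := y)]
        obtain ⟨w, hw⟩ := Submodule.Quotient.mk_surjective _ (y - z)
        rw [← hw, hg, Submodule.Quotient.mk_eq_zero, Submodule.Quotient.mk_eq_zero,
          Ideal.mem_span_singleton, Ideal.mem_span_singleton, pow_add, mul_comm]
        exact (mul_dvd_mul_iff_left (hne c)).1
      · rintro ⟨y, hy⟩
        obtain ⟨w, rfl⟩ := Submodule.Quotient.mk_surjective _ y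
        have hy' : r ^ (k + c) ∣ r ^ k * w := by
          rwa [← Submodule.Quotient.mk_smul, Submodule.Quotient.mk_eq_zero,
            Ideal.mem_span_singleton, smul_eq_mul] at hy
        rw [pow_add] at hy'
        obtain ⟨v, rfl⟩ := (mul_dvd_mul_iff_left (hne k)).1 hy'
        exact ⟨Submodule.Quotient.mk v, Subtype.ext (hg v)⟩
  · have hco : IsCoprime (p ^ k) (r ^ e) := by
      refine IsCoprime.pow ?_
      refine hp'.coprime_iff_not_dvd.2 fun hdvd => h ?_
      exact eq_of_monic_of_associated hx hp ((hp'.associated_of_dvd hx' hdvd).symm)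
    obtain ⟨a, b, hab⟩ := hco
    have : ∀ y : CycMod (r, e), p ^ k • y = 0 ↔ y = 0 := by
      intro y
      refine ⟨fun hy => ?_, by rintro rfl; simp⟩
      rw [← one_smul F[X] y, ← hab, add_smul, mul_smul, mul_smul, hy, pow_smul_cycMod (r, e)]
      simp
    rw [Nat.card_congr (Equiv.subtypeEquivRight this)]
    simp

variable {V V' : Type u} [AddCommGroup V] [Module F V] [AddCommGroup V'] [Module F V']

/-- `s` is the multiset of elementary divisors of `φ` -/
def HasED (φ : Module.End F V) (s : Multiset (F[X] × ℕ)) : Prop :=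
  IsPrimePowers s ∧ ∃ (ι : Type u) (_ : Fintype ι) (c : ι → F[X] × ℕ),
    Finset.univ.val.map c = s ∧ ∃ f : V ≃ₗ[F] (∀ i, CycMod (c i)), ∀ v, f (φ v) = (X : F[X]) • f v

lemma map_aeval_of_intertwine {M : Type*} [AddCommGroup M] [Module F M] [Module F[X] M]
    [IsScalarTower F F[X] M] {φ : Module.End F V} (f : V →ₗ[F] M)
    (hf : ∀ v, f (φ v) = (X : F[X]) • f v) (q : F[X]) (v : V) : f (aeval φ q v) = q • f v := by
  induction q using Polynomial.induction_on' generalizing v with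
  | add p q hp hq => simp [hp, hq, add_smul]
  | monomial n a =>
    rw [aeval_monomial, ← C_mul_X_pow_eq_monomial, mul_smul, Module.algebraMap_end_eq_smul_id]
    have : ∀ n v, f ((φ ^ n) v) = (X : F[X]) ^ n • f v := by
      intro n
      induction n with
      | zero => simp
      | succ n ih => intro v; rw [pow_succ, Module.End.mul_apply, ih, hf, pow_succ, mul_smul]
    rw [← algebraMap_eq, algebraMap_smul, ← this, ← map_smul]
    rfl

lemma HasED.natCard_ker [Finite F] {φ : Module.End F V} {s : Multiset (F[X] × ℕ)}
    (h : HasED φ s) {p : F[X]} (hp : p.Monic) (hp' : Irreducible p) (k : ℕ) :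
    Nat.card (LinearMap.ker (aeval φ (p ^ k))) =
      Nat.card F ^ (p.natDegree * kerWeight s p k) := by
  obtain ⟨hs, ι, _, c, rfl, f, hf⟩ := h
  have h1 : ∀ v, v ∈ LinearMap.ker (aeval φ (p ^ k)) ↔ ∀ i, p ^ k • f v i = 0 := by
    intro v
    rw [LinearMap.mem_ker, ← f.map_eq_zero_iff]
    have := map_aeval_of_intertwine f.toLinearMap hf (p ^ k) v
    rw [LinearEquiv.coe_coe] at this
    rw [this, funext_iff]
    rfl
  rw [Nat.card_congr (f.toEquiv.subtypeEquiv (q := fun y => ∀ i, p ^ k • y i = 0) h1),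
    Nat.card_congr (Equiv.subtypePiEquivPi (p := fun {i} y => p ^ k • (y : CycMod (c i)) = 0)),
    Nat.card_pi, kerWeight, Multiset.map_map, ← Finset.sum_eq_multiset_sum, Finset.mul_sum,
    ← Finset.prod_pow_eq_pow_sum]
  refine Finset.prod_congr rfl fun i _ => ?_
  have := hs (c i) (Multiset.mem_map_of_mem c (Finset.mem_univ_val i))
  rw [natCard_ker_cycMod this.1 this.2.1 hp hp']
  rfl

lemma HasED.congr {φ : Module.End F V} {φ' : Module.End F V'} {s : Multiset (F[X] × ℕ)}
    (h : HasED φ s) (g : V' ≃ₗ[F] V) (hg : ∀ v, g (φ' v) = φ (g v)) : HasED φ' s := by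
  obtain ⟨hs, ι, _, c, hc, f, hf⟩ := h
  exact ⟨hs, ι, inferInstance, c, hc, g.trans f, fun v => by simp [hg, hf]⟩

lemma hasED_of_subsingleton [Subsingleton V] (φ : Module.End F V) : HasED φ 0 :=
  ⟨by simp [IsPrimePowers], PEmpty, inferInstance, PEmpty.elim, by simp,
    { toFun := fun _ i => i.elim
      invFun := fun _ => 0
      map_add' := fun _ _ => Subsingleton.elim _ _
      map_smul' := fun _ _ => Subsingleton.elim _ _
      left_inv := fun _ => Subsingleton.elim _ _
      right_inv := fun _ => Subsingleton.elim _ _ }, fun _ => Subsingleton.elim _ _⟩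

lemma HasED.prodMap {φ : Module.End F V} {φ' : Module.End F V'} {s s' : Multiset (F[X] × ℕ)}
    (h : HasED φ s) (h' : HasED φ' s') : HasED (φ.prodMap φ') (s + s') := by
  obtain ⟨hs, ι, _, c, hc, f, hf⟩ := h
  obtain ⟨hs', ι', _, c', hc', f', hf'⟩ := h'
  refine ⟨fun x hx => (Multiset.mem_add.1 hx).elim (hs x) (hs' x), ι ⊕ ι', inferInstance,
    Sum.elim c c', ?_, (f.prodCongr f').trans
      (LinearEquiv.sumPiEquivProdPi F ι ι' fun i => CycMod (Sum.elim c c' i)).symm, fun v => ?_⟩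
  · rw [← hc, ← hc', ← Finset.univ_disjSum_univ, Finset.val_disjSum, Multiset.disjSum,
      Multiset.map_add, Multiset.map_map, Multiset.map_map]
    rfl
  · ext i
    rcases i with i | i
    · exact congrFun (hf v.1) i
    · exact congrFun (hf' v.2) i

lemma exists_equiv_of_map_eq {ι ι' : Type*} [Fintype ι] [Fintype ι'] {α : Type*} (c : ι → α)
    (c' : ι' → α) (h : (Finset.univ.val.map c : Multiset α) = Finset.univ.val.map c') :
    ∃ e : ι ≃ ι', ∀ i, c' (e i) = c i := by
  classical
  have : ∀ a, Nonempty ({i // c i = a} ≃ {i // c' i = a}) := by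
    intro a
    refine ⟨Fintype.equivOfCardEq ?_⟩
    have := congrArg (Multiset.count a) h
    rw [Multiset.count_map, Multiset.count_map] at this
    rw [Fintype.card_subtype, Fintype.card_subtype]
    simpa [Finset.card_def, eq_comm] using this
  exact ⟨Equiv.ofFiberEquiv fun a => (this a).some, fun i => Equiv.ofFiberEquiv_map _ i⟩

lemma HasED.exists_equiv {φ : Module.End F V} {φ' : Module.End F V'} {s : Multiset (F[X] × ℕ)}
    (h : HasED φ s) (h' : HasED φ' s) : ∃ g : V ≃ₗ[F] V', ∀ v, g (φ v) = φ' (g v) := by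
  obtain ⟨hs, ι, _, c, hc, f, hf⟩ := h
  obtain ⟨hs', ι', _, c', hc', f', hf'⟩ := h'
  obtain ⟨e, he⟩ := exists_equiv_of_map_eq c c' (hc.trans hc'.symm)
  obtain rfl : c = fun i => c' (e i) := funext fun i => (he i).symm
  let E := LinearEquiv.piCongrLeft F[X] (fun i => CycMod (c' i)) e
  refine ⟨(f.trans (E.restrictScalars F)).trans f'.symm, fun v => ?_⟩
  simp only [LinearEquiv.trans_apply]
  rw [f'.symm_apply_eq, hf', f'.apply_symm_apply, hf]
  exact E.map_smul _ _

lemma exists_hasED [FiniteDimensional F V] (φ : Module.End F V) : ∃ s, HasED φ s := by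
  classical
  obtain ⟨ι, _, p, hp, e, ⟨g⟩⟩ := Module.equiv_directSum_of_isTorsion
    (Module.AEval.isTorsion_of_finiteDimensional F V φ)
  let c : ι → F[X] × ℕ := fun i => (normalize (p i), e i)
  have hspan : ∀ i, Submodule.span F[X] {p i ^ e i} = Ideal.span {(c i).1 ^ (c i).2} := fun i =>
    Ideal.span_singleton_eq_span_singleton.2 ((associated_normalize (p i)).pow_pow)
  let g₁ : Module.AEval F V φ ≃ₗ[F[X]] ∀ i, CycMod (c i) :=
    (g.trans (DirectSum.linearEquivFunOnFintype F[X] ι _)).trans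
      (LinearEquiv.piCongrRight fun i => Submodule.quotEquivOfEq _ _ (hspan i))
  have hsub : ∀ i, e i = 0 → Subsingleton (CycMod (c i)) := by
    intro i hi
    rw [Ideal.Quotient.subsingleton_iff, Ideal.span_singleton_eq_top]
    simp [c, hi]
  let g₂ : (∀ i, CycMod (c i)) →ₗ[F[X]] ∀ i : {i // e i ≠ 0}, CycMod (c i) :=
    LinearMap.pi fun i => LinearMap.proj i.1
  have hg₂ : Function.Bijective g₂ := by
    constructor
    · intro x y h
      ext i
      by_cases hi : e i = 0
      · have := hsub i hi
        exact Subsingleton.elim _ _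
      · exact congrFun h ⟨i, hi⟩
    · intro y
      exact ⟨fun i => if h : e i ≠ 0 then y ⟨i, h⟩ else 0, by ext i; simp [g₂, i.2]⟩
  let g₃ := g₁.trans (LinearEquiv.ofBijective g₂ hg₂)
  refine ⟨Finset.univ.val.map fun i : {i // e i ≠ 0} => c i, ?_, {i // e i ≠ 0}, inferInstance,
    _, rfl, (Module.AEval.of F V φ).trans (g₃.restrictScalars F), fun v => ?_⟩
  · intro x hx
    obtain ⟨i, -, rfl⟩ := Multiset.mem_map.1 hx
    exact ⟨monic_normalize (hp i).ne_zero, (associated_normalize (p i)).irreducible (hp i),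
      Nat.pos_of_ne_zero i.2⟩
  · have := (Module.AEval'.X_smul_of φ v)
    change g₃ (Module.AEval'.of φ (φ v)) = _
    rw [← this, map_smul]
    rfl

lemma hasED_singleton {φ : Module.End F V} {x : F[X] × ℕ} (hx : x.1.Monic)
    (hx' : Irreducible x.1) (hx'' : 0 < x.2) (f : V ≃ₗ[F] CycMod x)
    (hf : ∀ v, f (φ v) = (X : F[X]) • f v) : HasED φ {x} := by
  refine ⟨by simpa [IsPrimePowers] using ⟨hx, hx', hx''⟩, PUnit, inferInstance, fun _ => x,
    by simp, f.trans (LinearEquiv.funUnique PUnit F (CycMod x)).symm, fun v => ?_⟩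
  ext i
  exact hf v

end ElementaryDivisors

section Companion
universe u
variable {F : Type u} [Field F]

lemma exists_basis_companion {f : F[X]} (hf : f.Monic) :
    ∃ b : Module.Basis (Fin f.natDegree) F (AdjoinRoot f), ∀ y,
      companion F f *ᵥ b.equivFun y = b.equivFun (AdjoinRoot.root f * y) := by
  have h := PowerBasis.leftMulMatrix (AdjoinRoot.powerBasis hf.ne_zero)
  rw [AdjoinRoot.powerBasis_gen, PowerBasis.minpolyGen_eq,
    AdjoinRoot.minpoly_powerBasis_gen_of_monic hf] at h
  let b : Module.Basis (Fin f.natDegree) F (AdjoinRoot f) :=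
    (AdjoinRoot.powerBasis hf.ne_zero).basis
  have hb : Algebra.leftMulMatrix b (AdjoinRoot.root f) = companion F f := by
    refine h.trans ?_
    ext i j
    have hi : (i : ℕ) < f.natDegree := i.2
    change (if (j : ℕ) + 1 = f.natDegree then -f.coeff i else if (i : ℕ) = j + 1 then 1 else 0) =
      if (i : ℕ) = j + 1 then 1 else if (j : ℕ) + 1 = f.natDegree then -f.coeff i else 0
    split_ifs <;> first | rfl | omega
  refine ⟨b, fun y => ?_⟩
  rw [← hb]
  exact Algebra.leftMulMatrix_mulVec_repr b _ y

lemma hasED_companion {p : F[X]} {l : ℕ} (hp : p.Monic) (hp' : Irreducible p) (hl : 0 < l) :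
    HasED (Matrix.toLin' (companion F (p ^ l))) {(p, l)} := by
  obtain ⟨b, hb⟩ := exists_basis_companion (hp.pow l)
  let f : (Fin (p ^ l).natDegree → F) ≃ₗ[F] CycMod (p, l) := b.equivFun.symm
  refine hasED_singleton (x := (p, l)) hp hp' hl f fun v => ?_
  obtain ⟨y, rfl⟩ := b.equivFun.surjective v
  have h1 : f (b.equivFun y) = y := b.equivFun.symm_apply_apply y
  rw [h1, Matrix.toLin'_apply, hb]
  refine (b.equivFun.symm_apply_apply _).trans ?_
  obtain ⟨w, rfl⟩ := AdjoinRoot.mk_surjective y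
  rfl

end Companion

section DualPoly
variable {F : Type*} [Field F] {σ : F →+* F}

lemma dualPoly_mul (f g : F[X]) : dualPoly σ (f * g) = dualPoly σ f * dualPoly σ g := by
  simp only [dualPoly, Polynomial.map_mul, reverse_mul_of_domain, mul_coeff_zero, map_mul,
    mul_inv]
  ring

lemma dualPoly_one : dualPoly σ (1 : F[X]) = 1 := by
  simp only [dualPoly, coeff_one_zero, map_one, inv_one, Polynomial.map_one, one_mul]
  rw [← C_1, reverse_C]

lemma dualPoly_pow (f : F[X]) (k : ℕ) : dualPoly σ (f ^ k) = dualPoly σ f ^ k := by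
  induction k with
  | zero => simp [dualPoly_one]
  | succ k ih => rw [pow_succ, dualPoly_mul, ih, pow_succ]

lemma coeff_zero_dualPoly (f : F[X]) :
    (dualPoly σ f).coeff 0 = (σ (f.coeff 0))⁻¹ * σ f.leadingCoeff := by
  simp [dualPoly, coeff_zero_reverse]

lemma coeff_zero_dualPoly_ne_zero {f : F[X]} (hf : f.coeff 0 ≠ 0) :
    (dualPoly σ f).coeff 0 ≠ 0 := by
  rw [coeff_zero_dualPoly]
  have : f ≠ 0 := by rintro rfl; simp at hf
  simpa [this] using hf

lemma natDegree_dualPoly {f : F[X]} (hf : f.coeff 0 ≠ 0) :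
    (dualPoly σ f).natDegree = f.natDegree := by
  rw [dualPoly, natDegree_C_mul (by simpa using hf), reverse_natDegree, natDegree_map,
    natTrailingDegree_eq_zero.2 (Or.inr (by simpa using hf)), Nat.sub_zero]

lemma monic_dualPoly {f : F[X]} (hf : f.coeff 0 ≠ 0) : (dualPoly σ f).Monic := by
  have h : (f.map σ).natTrailingDegree = 0 :=
    natTrailingDegree_eq_zero.2 (Or.inr (by simpa using hf))
  rw [Monic, dualPoly, leadingCoeff_mul, leadingCoeff_C, reverse_leadingCoeff, trailingCoeff, h,
    coeff_map]
  exact inv_mul_cancel₀ (by simpa using hf)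

lemma dualPoly_dualPoly (hσinv : ∀ a, σ (σ a) = a) {f : F[X]} (hf : f.Monic)
    (hf0 : f.coeff 0 ≠ 0) : dualPoly σ (dualPoly σ f) = f := by
  have h1 : (dualPoly σ f).natDegree = f.natDegree := natDegree_dualPoly hf0
  have h2 : (dualPoly σ f).coeff 0 = (σ (f.coeff 0))⁻¹ := by
    rw [coeff_zero_dualPoly, hf.leadingCoeff]; simp
  rw [dualPoly, h2, reverse, natDegree_map, h1, dualPoly, reverse, natDegree_map,
    Polynomial.map_mul, map_C, reflect_C_mul]
  have h3 : ((reflect f.natDegree (f.map σ)).map σ) = reflect f.natDegree f := by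
    rw [reflect_map, Polynomial.map_map, show σ.comp σ = RingHom.id F from RingHom.ext hσinv,
      Polynomial.map_id]
  have h4 : reflect f.natDegree (reflect f.natDegree f) = f := by
    ext i
    rw [coeff_reflect, coeff_reflect, revAt_invol]
  rw [h3, h4, ← mul_assoc, ← C_mul]
  simp [hσinv, hf0]

lemma irreducible_dualPoly (hσinv : ∀ a, σ (σ a) = a) {f : F[X]} (hf : f.Monic)
    (hf' : Irreducible f) (hf0 : f.coeff 0 ≠ 0) : Irreducible (dualPoly σ f) := by
  have hd := hf'.natDegree_pos
  rw [(monic_dualPoly hf0).irreducible_iff_natDegree]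
  refine ⟨fun h => ?_, fun a b ha hb hab => ?_⟩
  · have := natDegree_dualPoly (σ := σ) hf0
    rw [h, natDegree_one] at this
    omega
  · have h0 := coeff_zero_dualPoly_ne_zero (σ := σ) hf0
    rw [← hab, mul_coeff_zero] at h0
    have h := dualPoly_dualPoly hσinv hf hf0
    rw [← hab, dualPoly_mul] at h
    have := (hf.irreducible_iff_natDegree.1 hf').2 _ _
      (monic_dualPoly (σ := σ) (left_ne_zero_of_mul h0))
      (monic_dualPoly (σ := σ) (right_ne_zero_of_mul h0)) h
    rwa [natDegree_dualPoly (left_ne_zero_of_mul h0),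
      natDegree_dualPoly (right_ne_zero_of_mul h0)] at this

lemma dualPoly_eq_iff (hσinv : ∀ a, σ (σ a) = a) {f g : F[X]} (hf : f.Monic)
    (hf0 : f.coeff 0 ≠ 0) (hg : g.Monic) (hg0 : g.coeff 0 ≠ 0) :
    dualPoly σ f = g ↔ f = dualPoly σ g := by
  constructor
  · rintro rfl; rw [dualPoly_dualPoly hσinv hf hf0]
  · rintro rfl; rw [dualPoly_dualPoly hσinv hg hg0]

end DualPoly

section Duality
variable {F : Type*} [Field F] {σ : F →+* F}
variable {U W : Type*} [AddCommGroup U] [Module F U] [AddCommGroup W] [Module F W]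

lemma pairing_aeval_reflect {β : U →ₛₗ[σ] W →ₗ[F] F} {α : Module.End F U} {γ : Module.End F W}
    (h : ∀ u w, β (α u) (γ w) = β u w) (N : ℕ) (f : F[X]) (hf : f.natDegree ≤ N) (u : U) (w : W) :
    β (aeval α f u) ((γ ^ N) w) = β u (aeval γ (reflect N (f.map σ)) w) := by
  have hpow : ∀ n u w, β ((α ^ n) u) ((γ ^ n) w) = β u w := by
    intro n
    induction n with
    | zero => simp
    | succ n ih => intro u w; rw [pow_succ', pow_succ', Module.End.mul_apply,
        Module.End.mul_apply, h, ih]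
  refine induction_with_natDegree_le (fun f => β (aeval α f u) ((γ ^ N) w) =
    β u (aeval γ (reflect N (f.map σ)) w)) N (by simp) (fun n r hr hn => ?_)
    (fun f g _ _ h1 h2 => ?_) f hf
  · rw [Polynomial.map_mul, Polynomial.map_pow, map_C, map_X, reflect_C_mul_X_pow, revAt_le hn]
    simp only [map_mul, aeval_C, map_pow, aeval_X, Module.End.mul_apply,
      Module.algebraMap_end_apply, LinearMap.map_smulₛₗ, map_smul, LinearMap.smul_apply]
    obtain ⟨c, rfl⟩ := Nat.exists_eq_add_of_le hn
    rw [pow_add, Module.End.mul_apply, hpow, Nat.add_sub_cancel_left]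
  · simp only [map_add, LinearMap.add_apply, Polynomial.map_add, reflect_add, h1, h2]

lemma natCard_annihilator_range [Finite F] [FiniteDimensional F W] {β : U →ₛₗ[σ] W →ₗ[F] F}
    (hβ : Function.Bijective β) (T : Module.End F W) :
    Nat.card {u // ∀ w, β u (T w) = 0} = Nat.card (LinearMap.ker T) := by
  have h1 : Nat.card {u // ∀ w, β u (T w) = 0} = Nat.card (LinearMap.ker T.dualMap) :=
    Nat.card_congr ((Equiv.ofBijective β hβ).subtypeEquiv fun u => by
      rw [LinearMap.mem_ker, LinearMap.ext_iff]; rfl)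
  have h2 := T.finrank_range_add_finrank_ker
  have h3 := T.dualMap.finrank_range_add_finrank_ker
  rw [LinearMap.finrank_range_dualMap_eq_finrank_range, Subspace.dual_finrank_eq] at h3
  rw [h1, Module.natCard_eq_pow_finrank (K := F) (V := LinearMap.ker T),
    Module.natCard_eq_pow_finrank (K := F) (V := LinearMap.ker T.dualMap)]
  congr 1
  omega

lemma natCard_ker_dualPoly [Finite F] [FiniteDimensional F W] {β : U →ₛₗ[σ] W →ₗ[F] F}
    (hβ : Function.Bijective β) {α : Module.End F U} {γ : Module.End F W}
    (hγ : Function.Surjective γ) (h : ∀ u w, β (α u) (γ w) = β u w) {f : F[X]}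
    (hf : f.coeff 0 ≠ 0) :
    Nat.card (LinearMap.ker (aeval α f)) = Nat.card (LinearMap.ker (aeval γ (dualPoly σ f))) := by
  have hγN : ∀ N, Function.Surjective (γ ^ N : Module.End F W) := fun N => by
    rw [Module.End.coe_pow]; exact hγ.iterate N
  rw [← natCard_annihilator_range hβ]
  refine Nat.card_congr (Equiv.subtypeEquivRight fun u => ?_)
  have h1 : aeval α f u = 0 ↔ ∀ w, β (aeval α f u) ((γ ^ f.natDegree) w) = 0 := by
    rw [← map_eq_zero_iff β hβ.1, LinearMap.ext_iff]
    exact ⟨fun h w => h _, fun h w => by obtain ⟨v, rfl⟩ := hγN f.natDegree w; exact h v⟩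
  rw [LinearMap.mem_ker, h1]
  refine forall_congr' fun w => ?_
  rw [pairing_aeval_reflect h _ _ le_rfl, dualPoly, reverse, natDegree_map, map_mul, aeval_C,
    Module.End.mul_apply, Module.algebraMap_end_apply, map_smul, smul_eq_mul, mul_eq_zero]
  simp [hf]

end Duality

section DualED
universe u
variable {F : Type u} [Field F] {σ : F →+* F}
variable {U W : Type u} [AddCommGroup U] [Module F U] [AddCommGroup W] [Module F W]

/-- the multiset obtained by dualizing all polynomials -/
def dualED (σ : F →+* F) (s : Multiset (F[X] × ℕ)) : Multiset (F[X] × ℕ) :=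
  s.map fun x => (dualPoly σ x.1, x.2)

/-- all polynomials of the multiset have nonzero constant term -/
def NonzeroAtZero (s : Multiset (F[X] × ℕ)) : Prop := ∀ x ∈ s, x.1.coeff 0 ≠ 0

lemma HasED.nonzeroAtZero [Finite F] {φ : Module.End F U} {s : Multiset (F[X] × ℕ)}
    (h : HasED φ s) (hφ : Function.Injective φ) : NonzeroAtZero s := by
  classical
  intro x hx hx0
  obtain ⟨hm, hi, hpos⟩ := h.1 x hx
  have hX : x.1 = X := by
    refine (eq_of_monic_of_associated monic_X hm ?_).symm
    exact (irreducible_X.associated_of_dvd hi (X_dvd_iff.2 hx0))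
  have h1 := h.natCard_ker monic_X irreducible_X 1
  rw [pow_one, aeval_X, LinearMap.ker_eq_bot.2 hφ, natDegree_X, one_mul] at h1
  have h2 : kerWeight s X 1 = 0 := by
    have h3 : 1 < Nat.card F := Finite.one_lt_card
    by_contra hne
    have := Nat.one_lt_pow hne h3
    simp at h1
    omega
  rw [kerWeight, Multiset.sum_eq_zero_iff] at h2
  have := h2 _ (Multiset.mem_map_of_mem _ hx)
  rw [if_pos hX] at this
  omega

lemma kerWeight_eq_zero {s : Multiset (F[X] × ℕ)} {p : F[X]} (k : ℕ) (h : ∀ x ∈ s, x.1 ≠ p) :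
    kerWeight s p k = 0 := by
  rw [kerWeight, Multiset.sum_eq_zero_iff]
  intro a ha
  obtain ⟨x, hx, rfl⟩ := Multiset.mem_map.1 ha
  rw [if_neg (h x hx)]

lemma IsPrimePowers.dualED (hσinv : ∀ a, σ (σ a) = a) {s : Multiset (F[X] × ℕ)}
    (hs : IsPrimePowers s) (hs0 : NonzeroAtZero s) : IsPrimePowers (dualED σ s) := by
  intro x hx
  obtain ⟨y, hy, rfl⟩ := Multiset.mem_map.1 hx
  obtain ⟨h1, h2, h3⟩ := hs y hy
  exact ⟨monic_dualPoly (hs0 y hy), irreducible_dualPoly hσinv h1 h2 (hs0 y hy), h3⟩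

lemma NonzeroAtZero.dualED {s : Multiset (F[X] × ℕ)} (hs0 : NonzeroAtZero s) :
    NonzeroAtZero (dualED σ s) := by
  intro x hx
  obtain ⟨y, hy, rfl⟩ := Multiset.mem_map.1 hx
  exact coeff_zero_dualPoly_ne_zero (hs0 y hy)

lemma kerWeight_dualED (hσinv : ∀ a, σ (σ a) = a) {s : Multiset (F[X] × ℕ)}
    (hs : IsPrimePowers s) (hs0 : NonzeroAtZero s) {p : F[X]} (hp : p.Monic)
    (hp0 : p.coeff 0 ≠ 0) (k : ℕ) :
    kerWeight (dualED σ s) p k = kerWeight s (dualPoly σ p) k := by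
  simp only [kerWeight, Can.dualED, Multiset.map_map, Function.comp_def]
  congr 1
  refine Multiset.map_congr rfl fun x hx => ?_
  classical exact if_congr (dualPoly_eq_iff hσinv (hs x hx).1 (hs0 x hx) hp hp0) rfl rfl

lemma HasED.dual [Finite F] [FiniteDimensional F W] (hσinv : ∀ a, σ (σ a) = a)
    {β : U →ₛₗ[σ] W →ₗ[F] F} (hβ : Function.Bijective β) {α : Module.End F U}
    {γ : Module.End F W} (hγ : Function.Bijective γ) (h : ∀ u w, β (α u) (γ w) = β u w)
    {s : Multiset (F[X] × ℕ)} (hs : HasED α s) (hs0 : NonzeroAtZero s) :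
    HasED γ (dualED σ s) := by
  obtain ⟨t, ht⟩ := exists_hasED γ
  suffices t = dualED σ s by rwa [← this]
  have ht0 := ht.nonzeroAtZero hγ.1
  refine ht.1.eq_of_kerWeight (hs.1.dualED hσinv hs0) fun p hp hp' k => ?_
  by_cases hp0 : p.coeff 0 = 0
  · rw [kerWeight_eq_zero k fun x hx hxp => ht0 x hx (hxp ▸ hp0),
      kerWeight_eq_zero k fun x hx hxp => hs0.dualED x hx (hxp ▸ hp0)]
  · have h1 := ht.natCard_ker hp hp' k
    have h2 := hs.natCard_ker (monic_dualPoly (σ := σ) hp0)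
      (irreducible_dualPoly hσinv hp hp' hp0) k
    rw [natCard_ker_dualPoly hβ hγ.2 h, dualPoly_pow, dualPoly_dualPoly hσinv hp hp0, h1,
      natDegree_dualPoly hp0] at h2
    · rw [kerWeight_dualED hσinv hs.1 hs0 hp hp0]
      exact Nat.eq_of_mul_eq_mul_left hp'.natDegree_pos
        (Nat.pow_right_injective (Finite.one_lt_card (α := F)) h2)
    · rw [coeff_zero_eq_eval_zero, eval_pow, ← coeff_zero_eq_eval_zero]
      exact pow_ne_zero _ (coeff_zero_dualPoly_ne_zero hp0)

end DualED

section NSForm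
universe u
variable {F : Type u} [Field F] {σ : F →+* F}
variable {V V' : Type u} [AddCommGroup V] [Module F V] [AddCommGroup V'] [Module F V']

lemma HasED.unique [Finite F] {φ : Module.End F V} {s t : Multiset (F[X] × ℕ)}
    (hs : HasED φ s) (ht : HasED φ t) : s = t := by
  refine hs.1.eq_of_kerWeight ht.1 fun p hp hp' k => ?_
  have h := (hs.natCard_ker hp hp' k).symm.trans (ht.natCard_ker hp hp' k)
  exact Nat.eq_of_mul_eq_mul_left hp'.natDegree_pos
    (Nat.pow_right_injective (Finite.one_lt_card (α := F)) h)

lemma HasED.injective [Finite F] [FiniteDimensional F V] {φ : Module.End F V}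
    {s : Multiset (F[X] × ℕ)} (hs : HasED φ s) (hs0 : NonzeroAtZero s) :
    Function.Injective φ := by
  have : Finite V := Module.finite_of_finite F
  have h := hs.natCard_ker monic_X irreducible_X 1
  rw [kerWeight_eq_zero 1 fun x hx hxX => hs0 x hx (by simp [hxX]), mul_zero, pow_zero, pow_one,
    aeval_X, Nat.card_eq_one_iff_unique] at h
  rw [← LinearMap.ker_eq_bot]
  exact (Submodule.subsingleton_iff_eq_bot).1 h.1

/-- `B` is nondegenerate and `s` is the multiset of elementary divisors of its cosquare -/
def NSForm (B : V →ₛₗ[σ] V →ₗ[F] F) (s : Multiset (F[X] × ℕ)) : Prop :=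
  RNondeg B ∧ ∃ φ : V ≃ₗ[F] V, (∀ x y, B x y = σ (B (φ y) x)) ∧ HasED φ.toLinearMap s

variable {B : V →ₛₗ[σ] V →ₗ[F] F} {B' : V' →ₛₗ[σ] V' →ₗ[F] F} {s s' : Multiset (F[X] × ℕ)}

lemma NSForm.congr (h : NSForm B s) (e : Isom B B') : NSForm B' s := by
  obtain ⟨g, hg⟩ := e.symm
  obtain ⟨hB, φ, hφ, hs⟩ := h
  refine ⟨fun y hy => ?_, (g.trans φ).trans g.symm, fun x y => ?_, hs.congr g fun v => ?_⟩
  · rw [← map_eq_zero_iff g g.injective]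
    refine hB _ fun x => ?_
    obtain ⟨z, rfl⟩ := g.surjective x
    rw [hg, hy]
  · rw [← hg, hφ, ← hg ((g.trans φ).trans g.symm y)]
    simp
  · simp

lemma NSForm.prod (h : NSForm B s) (h' : NSForm B' s') : NSForm (prodForm B B') (s + s') := by
  obtain ⟨hB, φ, hφ, hs⟩ := h
  obtain ⟨hB', φ', hφ', hs'⟩ := h'
  refine ⟨fun y hy => Prod.ext (hB _ fun x => ?_) (hB' _ fun x => ?_), φ.prodCongr φ',
    fun x y => ?_, hs.prodMap hs'⟩
  · simpa using hy (x, 0)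
  · simpa using hy (0, x)
  · simp [hφ x.1, hφ' x.2]

lemma nsForm_of_subsingleton [Subsingleton V] (B : V →ₛₗ[σ] V →ₗ[F] F) : NSForm B 0 :=
  ⟨fun _ _ => Subsingleton.elim _ _, LinearEquiv.refl F V, fun x y => by
    rw [Subsingleton.elim x 0, Subsingleton.elim y 0]; simp, hasED_of_subsingleton _⟩

lemma NSForm.card_nilSet (h : NSForm B s) (i : ℕ) : Nat.card (nilSet B i) = 1 := by
  obtain ⟨hB, φ, hφ, -⟩ := h
  exact card_nilSet_of_cosquare hB hφ i

lemma NSForm.card_nilRadSet (h : NSForm B s) (i : ℕ) : Nat.card (nilRadSet B i) = 1 := by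
  obtain ⟨hB, φ, hφ, -⟩ := h
  exact card_nilRadSet_of_cosquare hB hφ i

lemma NSForm.isPrimePowers (h : NSForm B s) : IsPrimePowers s := by
  obtain ⟨hB, φ, hφ, hs⟩ := h
  exact hs.1

variable [Finite F]

lemma NSForm.nonzeroAtZero (h : NSForm B s) : NonzeroAtZero s := by
  obtain ⟨hB, φ, hφ, hs⟩ := h
  exact hs.nonzeroAtZero φ.injective

lemma NSForm.card_trajSet (h : NSForm B s) {p : F[X]} (hp : p.Monic) (hp' : Irreducible p)
    (k : ℕ) : Nat.card (trajSet B (p ^ k)) = Nat.card F ^ (p.natDegree * kerWeight s p k) := by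
  obtain ⟨hB, φ, hφ, hs⟩ := h
  rw [card_trajSet_of_cosquare hB hφ, hs.natCard_ker hp hp']

variable [FiniteDimensional F V]

lemma NSForm.isom (hchar : (2 : F) ≠ 0) (hσinv : ∀ a, σ (σ a) = a) (hσ : σ ≠ RingHom.id F)
    (h : NSForm B s) (h' : NSForm B' s) : Isom B B' := by
  obtain ⟨hB, φ, hφ, hs⟩ := h
  obtain ⟨hB', φ', hφ', hs'⟩ := h'
  obtain ⟨g, hg⟩ := hs.exists_equiv hs'
  exact Isom.of_cosquare hchar hσinv hσ hB hB' φ φ' hφ hφ' g hg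

lemma RNondeg.exists_nsForm (hσinv : ∀ a, σ (σ a) = a) (hB : RNondeg B) : ∃ s, NSForm B s := by
  obtain ⟨φ, hφ⟩ := hB.exists_cosquare hσinv
  obtain ⟨s, hs⟩ := exists_hasED φ.toLinearMap
  exact ⟨s, hB, φ, hφ, hs⟩

lemma NSForm.dualED_eq (hσinv : ∀ a, σ (σ a) = a) (h : NSForm B s) : dualED σ s = s := by
  have h0 := h.nonzeroAtZero
  obtain ⟨hB, φ, hφ, hs⟩ := h
  have := hs.dual hσinv (hB.bijective hσinv) φ.bijective (fun u w => ?_) h0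
  · exact this.unique hs
  · change B (φ u) (φ w) = B u w
    rw [hφ u w, hφ (φ w) u, hσinv]

end NSForm

section NSBlocks
universe u
variable {F : Type u} [Field F] {σ : F →+* F}

lemma rNondeg_matForm {ι : Type} [Fintype ι] [DecidableEq ι] {M : Matrix ι ι F}
    (hM : IsUnit M.det) : RNondeg (matForm σ M) := by
  intro y hy
  refine (Matrix.mulVec_injective_iff_isUnit.2 ((Matrix.isUnit_iff_isUnit_det _).2 hM)) ?_
  rw [mulVec_zero]
  ext i
  have h2 : σ ∘ (Pi.single i 1 : ι → F) = Pi.single i 1 := by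
    ext j
    by_cases hj : j = i
    · subst hj; simp
    · simp [hj]
  have := hy (Pi.single i 1)
  rw [matForm_apply, h2] at this
  simpa using this

variable [Finite F]

lemma nsForm_matForm (hσinv : ∀ a, σ (σ a) = a) {ι : Type} [Fintype ι] [DecidableEq ι]
    {M C : Matrix ι ι F} (hM : IsUnit M.det) (h : M = (M.map σ)ᵀ * C)
    {s : Multiset (F[X] × ℕ)} (hs : HasED (Matrix.toLin' C) s) (hs0 : NonzeroAtZero s) :
    NSForm (matForm σ M) s := by
  have hinj := hs.injective hs0
  refine ⟨rNondeg_matForm hM, LinearEquiv.ofInjectiveEndo _ hinj, fun x y => ?_, hs⟩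
  · change σ ∘ x ⬝ᵥ M *ᵥ y = σ (σ ∘ (C *ᵥ y) ⬝ᵥ M *ᵥ x)
    have h3 : σ (σ ∘ (C *ᵥ y) ⬝ᵥ M *ᵥ x) = (C *ᵥ y) ⬝ᵥ (M.map σ) *ᵥ (σ ∘ x) := by
      rw [RingHom.map_dotProduct]
      congr 1
      · ext i; simp [hσinv]
      · ext i; exact RingHom.map_mulVec σ M x i
    have h4 : M *ᵥ y = (M.map σ)ᵀ *ᵥ (C *ᵥ y) := by rw [mulVec_mulVec, ← h]
    rw [h3, h4, dotProduct_transpose_mulVec]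

lemma nsForm_sqrt (hσinv : ∀ a, σ (σ a) = a) {p : F[X]} {l : ℕ} (hp : p.Monic)
    (hp' : Irreducible p) (hl : 0 < l) (hp0 : p.coeff 0 ≠ 0) {M : Mat F (p ^ l).natDegree}
    (hM : IsUnit M.det) (h : M = ctr σ M * companion F (p ^ l)) :
    NSForm (matForm σ M) {(p, l)} :=
  nsForm_matForm hσinv hM h (hasED_companion hp hp' hl) (by simpa [NonzeroAtZero] using hp0)

lemma nsForm_skewSum (hσinv : ∀ a, σ (σ a) = a) {n : ℕ} {C : Mat F n}
    {s : Multiset (F[X] × ℕ)} (hs : HasED (Matrix.toLin' C) s) (hs0 : NonzeroAtZero s) :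
    NSForm (matForm σ (skewSum C 1)) (s + dualED σ s) := by
  refine NSForm.congr ?_ (matForm_reindex_isom finSumFinEquiv _).symm
  have hC : IsUnit C := Matrix.mulVec_injective_iff_isUnit.1 (hs.injective hs0)
  have hC' : IsUnit (C.map σ)ᵀ := by
    rw [Matrix.isUnit_transpose]
    exact hC.map (RingHom.mapMatrix σ)
  obtain ⟨D, hD⟩ := hC'.exists_right_inv
  have hD' : IsUnit D := IsUnit.of_mul_eq_one _ (mul_eq_one_comm.1 hD)
  have hdual : HasED (Matrix.toLin' D) (dualED σ s) := by
    refine hs.dual (β := matForm σ 1) hσinv ?_ ?_ ?_ hs0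
    · exact (rNondeg_matForm (by simp)).bijective hσinv
    · exact Finite.injective_iff_bijective.1 (Matrix.mulVec_injective_iff_isUnit.2 hD')
    · intro u w
      simp only [matForm_apply, Matrix.toLin'_apply, one_mulVec]
      have : σ ∘ (C *ᵥ u) = C.map σ *ᵥ (σ ∘ u) := by ext i; exact RingHom.map_mulVec σ C u i
      rw [this, dotProduct_comm, ← dotProduct_transpose_mulVec, mulVec_mulVec, hD, one_mulVec]
  have hED : HasED (Matrix.toLin' (fromBlocks C 0 0 D)) (s + dualED σ s) :=
    (hs.prodMap hdual).congr (LinearEquiv.sumArrowLequivProdArrow _ _ F F) fun v => by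
      rw [Matrix.toLin'_apply, fromBlocks_mulVec]
      ext i <;> simp [LinearEquiv.sumArrowLequivProdArrow] <;> rfl
  refine nsForm_matForm hσinv ?_ ?_ hED ?_
  · rw [← Matrix.isUnit_iff_isUnit_det]
    refine IsUnit.of_mul_eq_one (fromBlocks 0 (C⁻¹) 1 0) ?_
    rw [fromBlocks_multiply]
    simp [Matrix.mul_nonsing_inv _ ((Matrix.isUnit_iff_isUnit_det _).1 hC)]
  · rw [fromBlocks_map, fromBlocks_transpose, fromBlocks_multiply, hD]
    simp
  · intro x hx
    rcases Multiset.mem_add.1 hx with hx | hx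
    · exact hs0 x hx
    · exact hs0.dualED x hx

lemma nsForm_skewIBlock1 (hσinv : ∀ a, σ (σ a) = a) {p : F[X]} {l : ℕ} (hp : p.Monic)
    (hp' : Irreducible p) (hl : 0 < l) (hp0 : p.coeff 0 ≠ 0) :
    NSForm (matForm σ (skewIBlock1 (p ^ l)).2) {(p, l), (dualPoly σ p, l)} :=
  nsForm_skewSum hσinv (hasED_companion hp hp' hl) (by simpa [NonzeroAtZero] using hp0)

end NSBlocks

section Combinatorics

lemma multiset_eq_of_weights {s t : Multiset ℕ} (hs : ∀ n ∈ s, 0 < n) (ht : ∀ n ∈ t, 0 < n)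
    (h : ∀ i, (s.map fun n => min i ((n + 1) / 2)).sum = (t.map fun n => min i ((n + 1) / 2)).sum)
    (h' : ∀ i, (s.map fun n => if n % 2 = 1 ∧ n < 2 * i then 1 else 0).sum =
      (t.map fun n => if n % 2 = 1 ∧ n < 2 * i then 1 else 0).sum) : s = t := by
  have hodd : ∀ (u : Multiset ℕ) (i : ℕ), u.count (2 * i + 1) +
      (u.map fun n => if n % 2 = 1 ∧ n < 2 * i then 1 else 0).sum =
      (u.map fun n => if n % 2 = 1 ∧ n < 2 * (i + 1) then 1 else 0).sum := by
    intro u i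
    induction u using Multiset.induction_on with
    | empty => simp
    | cons a u ih =>
      simp only [Multiset.count_cons, Multiset.map_cons, Multiset.sum_cons]
      split_ifs <;> omega
  have heven : ∀ (u : Multiset ℕ) (i : ℕ), u.count (2 * i + 2) + u.count (2 * i + 1) +
      (u.map fun n => min i ((n + 1) / 2)).sum + (u.map fun n => min (i + 2) ((n + 1) / 2)).sum =
      2 * (u.map fun n => min (i + 1) ((n + 1) / 2)).sum := by
    intro u i
    induction u using Multiset.induction_on with
    | empty => simp
    | cons a u ih =>
      simp only [Multiset.count_cons, Multiset.map_cons, Multiset.sum_cons]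
      split_ifs <;> omega
  ext m
  rcases Nat.even_or_odd' m with ⟨i, rfl | rfl⟩
  · rcases i with _ | i
    · rw [Multiset.count_eq_zero_of_notMem fun hm => (hs _ hm).ne' rfl,
        Multiset.count_eq_zero_of_notMem fun hm => (ht _ hm).ne' rfl]
    · have h1 := heven s i
      have h2 := heven t i
      have h3 := hodd s i
      have h4 := hodd t i
      rw [h, h, h] at h1
      rw [h', h'] at h3
      rw [show 2 * (i + 1) = 2 * i + 2 by ring]
      omega
  · have h3 := hodd s i
    have h4 := hodd t i
    rw [h', h'] at h3
    omega

lemma exists_perm_forall₂_of_rel {α β : Type*} {r : α → β → Prop} {l : List α} {l' : List β}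
    (h : Multiset.Rel r (l : Multiset α) (l' : Multiset β)) :
    ∃ l'' : List α, l.Perm l'' ∧ List.Forall₂ r l'' l' := by
  suffices ∀ (s : Multiset α) (l' : List β), Multiset.Rel r s (l' : Multiset β) →
      ∃ l'' : List α, (l'' : Multiset α) = s ∧ List.Forall₂ r l'' l' by
    obtain ⟨l'', h1, h2⟩ := this _ _ h
    exact ⟨l'', (Multiset.coe_eq_coe.1 h1).symm, h2⟩
  intro s l' h
  induction l' generalizing s with
  | nil =>
    rw [Multiset.coe_nil, Multiset.rel_zero_right] at h
    exact ⟨[], by simp [h], List.Forall₂.nil⟩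
  | cons b l' ih =>
    rw [← Multiset.cons_coe, Multiset.rel_cons_right] at h
    obtain ⟨a, s', hab, hs', rfl⟩ := h
    obtain ⟨l'', h1, h2⟩ := ih _ hs'
    exact ⟨a :: l'', by rw [← Multiset.cons_coe, h1], List.Forall₂.cons hab h2⟩

end Combinatorics

section Assembly
universe u
variable {F : Type u} [Field F]

/-- admissible labels of the nonsingular canonical blocks -/
def IsLabel (x : F[X] × ℕ) : Prop :=
  x.1.Monic ∧ Irreducible x.1 ∧ 0 < x.2 ∧ x.1.coeff 0 ≠ 0

open scoped Classical in
/-- the elementary divisors of the cosquare of the canonical block with label `x` -/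
def labelED (σ : F →+* F) (x : F[X] × ℕ) : Multiset (F[X] × ℕ) :=
  if dualPoly σ x.1 = x.1 then {x} else {x, (dualPoly σ x.1, x.2)}

open scoped Classical in
/-- the nonsingular canonical block with label `x` -/
def labelBlock (σ : F →+* F) (sqrtS : (q : F[X]) → Mat F q.natDegree) (x : F[X] × ℕ) : Block F :=
  if dualPoly σ x.1 = x.1 then ⟨(x.1 ^ x.2).natDegree, sqrtS (x.1 ^ x.2)⟩
  else skewIBlock1 (x.1 ^ x.2)

/-- labels of equivalent blocks -/
def LabelRel (σ : F →+* F) (x y : F[X] × ℕ) : Prop :=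
  x = y ∨ dualPoly σ x.1 ≠ x.1 ∧ y = (dualPoly σ x.1, x.2)

variable {σ : F →+* F}

lemma mem_labelED (x : F[X] × ℕ) : x ∈ labelED σ x := by
  rw [labelED]; split_ifs <;> simp

lemma labelED_dual (hσinv : ∀ a, σ (σ a) = a) {x : F[X] × ℕ} (hx : IsLabel x) :
    labelED σ (dualPoly σ x.1, x.2) = labelED σ x := by
  have h := dualPoly_dualPoly hσinv hx.1 hx.2.2.2
  by_cases hd : dualPoly σ x.1 = x.1
  · simp [hd]
  · have hd' : ¬ dualPoly σ (dualPoly σ x.1) = dualPoly σ x.1 := by rw [h]; exact Ne.symm hd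
    rw [labelED, labelED, if_neg hd, if_neg hd', h]
    exact Multiset.pair_comm _ _

lemma labelRel_of_mem (hσinv : ∀ a, σ (σ a) = a) {x y : F[X] × ℕ} (hy : IsLabel y)
    (h : x ∈ labelED σ y) : LabelRel σ x y ∧ labelED σ x = labelED σ y := by
  by_cases hd : dualPoly σ y.1 = y.1
  · rw [labelED, if_pos hd, Multiset.mem_singleton] at h
    subst h
    exact ⟨Or.inl rfl, rfl⟩
  · rw [labelED, if_neg hd] at h
    simp only [Multiset.insert_eq_cons, Multiset.mem_cons, Multiset.mem_singleton] at h
    rcases h with rfl | rfl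
    · exact ⟨Or.inl rfl, rfl⟩
    · refine ⟨Or.inr ?_, labelED_dual hσinv hy⟩
      simp only [dualPoly_dualPoly hσinv hy.1 hy.2.2.2]
      exact ⟨Ne.symm hd, trivial⟩

lemma rel_labelRel (hσinv : ∀ a, σ (σ a) = a) {s t : Multiset (F[X] × ℕ)}
    (ht : ∀ x ∈ t, IsLabel x) (h : (s.map (labelED σ)).sum = (t.map (labelED σ)).sum) :
    Multiset.Rel (LabelRel σ) s t := by
  induction s using Multiset.induction_on generalizing t with
  | empty =>
    rw [Multiset.rel_zero_left]
    rw [Multiset.map_zero, Multiset.sum_zero] at h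
    by_contra hne
    obtain ⟨y, hy⟩ := Multiset.exists_mem_of_ne_zero hne
    have : y ∈ (t.map (labelED σ)).sum :=
      Multiset.mem_join.2 ⟨_, Multiset.mem_map_of_mem _ hy, mem_labelED y⟩
    rw [← h] at this
    simp at this
  | cons x s ih =>
    have hx : x ∈ (t.map (labelED σ)).sum := by
      rw [← h, Multiset.map_cons, Multiset.sum_cons]
      exact Multiset.mem_add.2 (Or.inl (mem_labelED x))
    obtain ⟨u, hu, hxu⟩ := Multiset.mem_join.1 hx
    obtain ⟨y, hy, rfl⟩ := Multiset.mem_map.1 hu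
    obtain ⟨h1, h2⟩ := labelRel_of_mem hσinv (ht y hy) hxu
    obtain ⟨t, rfl⟩ := Multiset.exists_cons_of_mem hy
    refine Multiset.Rel.cons h1 (ih (fun z hz => ht z (Multiset.mem_cons_of_mem hz)) ?_)
    rw [Multiset.map_cons, Multiset.map_cons, Multiset.sum_cons, Multiset.sum_cons, h2] at h
    exact add_left_cancel h

lemma exists_labels (hσinv : ∀ a, σ (σ a) = a) (s : Multiset (F[X] × ℕ)) (hs : IsPrimePowers s)
    (hs0 : NonzeroAtZero s) (h : dualED σ s = s) :
    ∃ t : List (F[X] × ℕ), (∀ x ∈ t, IsLabel x) ∧ (t.map (labelED σ)).sum = s := by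
  induction hc : s.card using Nat.strong_induction_on generalizing s with
  | _ c ih =>
  by_cases hne : s = 0
  · exact ⟨[], by simp, by simp [hne]⟩
  obtain ⟨x, hx⟩ := Multiset.exists_mem_of_ne_zero hne
  have hlab : IsLabel x := ⟨(hs x hx).1, (hs x hx).2.1, (hs x hx).2.2, hs0 x hx⟩
  suffices ∃ s', s = labelED σ x + s' ∧ dualED σ s' = s' by
    obtain ⟨s', rfl, hs'⟩ := this
    have hpos : 0 < (labelED σ x).card := Multiset.card_pos_iff_exists_mem.2 ⟨x, mem_labelED x⟩
    rw [Multiset.card_add] at hc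
    obtain ⟨t, ht, hts⟩ := ih s'.card (by omega) s'
      (fun y hy => hs y (Multiset.mem_add.2 (Or.inr hy)))
      (fun y hy => hs0 y (Multiset.mem_add.2 (Or.inr hy))) hs' rfl
    exact ⟨x :: t, List.forall_mem_cons.2 ⟨hlab, ht⟩, by rw [List.map_cons, List.sum_cons, hts]⟩
  clear ih
  obtain ⟨s', rfl⟩ := Multiset.exists_cons_of_mem hx
  by_cases hd : dualPoly σ x.1 = x.1
  · refine ⟨s', by rw [labelED, if_pos hd, Multiset.singleton_add], ?_⟩
    rw [dualED, Multiset.map_cons, hd] at h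
    exact (Multiset.cons_inj_right _).1 h
  · have hy : (dualPoly σ x.1, x.2) ∈ dualED σ (x ::ₘ s') := Multiset.mem_map.2 ⟨x, hx, rfl⟩
    rw [h] at hy
    rcases Multiset.mem_cons.1 hy with hy | hy
    · exact absurd (congrArg Prod.fst hy) hd
    obtain ⟨s'', rfl⟩ := Multiset.exists_cons_of_mem hy
    refine ⟨s'', by
      rw [labelED, if_neg hd, Multiset.insert_eq_cons, Multiset.cons_add,
        Multiset.singleton_add], ?_⟩
    rw [dualED, Multiset.map_cons, Multiset.map_cons, dualPoly_dualPoly hσinv hlab.1 hlab.2.2.2,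
      Multiset.cons_swap] at h
    exact (Multiset.cons_inj_right _).1 ((Multiset.cons_inj_right _).1 h)

end Assembly

section Classification
universe u
variable {F : Type u} [Field F] {σ : F →+* F} {sqrtS : (q : F[X]) → Mat F q.natDegree}

/-- `sqrtS` chooses a *-square root of every Frobenius block that has one -/
def IsSqrt (σ : F →+* F) (sqrtS : (q : F[X]) → Mat F q.natDegree) : Prop :=
  ∀ (pp : F[X]) (l : ℕ), pp.Monic → Irreducible pp → 0 < l →
    (pp ^ l).eval 0 ≠ 0 → dualPoly σ pp = pp →
    IsUnit (sqrtS (pp ^ l)).det ∧ sqrtS (pp ^ l) = ctr σ (sqrtS (pp ^ l)) * companion F (pp ^ l)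

lemma eval_pow_ne_zero {p : F[X]} {l : ℕ} (hp : p.coeff 0 ≠ 0) : (p ^ l).eval 0 ≠ 0 := by
  rw [eval_pow, ← coeff_zero_eq_eval_zero]
  exact pow_ne_zero _ hp

lemma coeff_zero_ne_zero_of_eval_pow {p : F[X]} {l : ℕ} (hl : 0 < l) (h : (p ^ l).eval 0 ≠ 0) :
    p.coeff 0 ≠ 0 := by
  rw [eval_pow, ← coeff_zero_eq_eval_zero] at h
  exact (pow_ne_zero_iff hl.ne').1 h

lemma nsForm_labelBlock [Finite F] (hσinv : ∀ a, σ (σ a) = a) (hsq : IsSqrt σ sqrtS)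
    {x : F[X] × ℕ} (hx : IsLabel x) :
    NSForm (matForm σ (labelBlock σ sqrtS x).2) (labelED σ x) := by
  obtain ⟨h1, h2, h3, h4⟩ := hx
  by_cases hd : dualPoly σ x.1 = x.1
  · rw [labelBlock, labelED, if_pos hd, if_pos hd]
    obtain ⟨h5, h6⟩ := hsq x.1 x.2 h1 h2 h3 (eval_pow_ne_zero h4) hd
    exact nsForm_sqrt hσinv h1 h2 h3 h4 h5 h6
  · rw [labelBlock, labelED, if_neg hd, if_neg hd]
    exact nsForm_skewIBlock1 hσinv h1 h2 h3 h4

lemma labelBlock_type {x : F[X] × ℕ} (hx : IsLabel x) :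
    T1ii σ (labelBlock σ sqrtS x) ∨ T1iii σ sqrtS (labelBlock σ sqrtS x) := by
  obtain ⟨h1, h2, h3, h4⟩ := hx
  by_cases hd : dualPoly σ x.1 = x.1
  · exact Or.inr ⟨x.1, x.2, h1, h2, h3, eval_pow_ne_zero h4, hd, by rw [labelBlock, if_pos hd]⟩
  · exact Or.inl ⟨x.1, x.2, h1, h2, h3, eval_pow_ne_zero h4, hd, by rw [labelBlock, if_neg hd]⟩

lemma exists_label {b : Block F} (hb : T1ii σ b ∨ T1iii σ sqrtS b) :
    ∃ x, IsLabel x ∧ b = labelBlock σ sqrtS x := by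
  rcases hb with ⟨p, l, h1, h2, h3, h4, h5, rfl⟩ | ⟨p, l, h1, h2, h3, h4, h5, rfl⟩
  · exact ⟨(p, l), ⟨h1, h2, h3, coeff_zero_ne_zero_of_eval_pow h3 h4⟩, by
      rw [labelBlock, if_neg h5]⟩
  · exact ⟨(p, l), ⟨h1, h2, h3, coeff_zero_ne_zero_of_eval_pow h3 h4⟩, by
      rw [labelBlock, if_pos h5]⟩

lemma LabelRel.equiv1 (hσinv : ∀ a, σ (σ a) = a) {x y : F[X] × ℕ} (hx : IsLabel x)
    (h : LabelRel σ x y) : Equiv1 σ (labelBlock σ sqrtS x) (labelBlock σ sqrtS y) := by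
  obtain ⟨h1, h2, h3, h4⟩ := hx
  rcases h with rfl | ⟨hd, rfl⟩
  · exact Or.inl rfl
  · refine Or.inr ⟨x.1, x.2, h1, h2, h3, eval_pow_ne_zero h4, hd, by rw [labelBlock, if_neg hd], ?_⟩
    have hd' : ¬ dualPoly σ (dualPoly σ x.1) = dualPoly σ x.1 := by
      rw [dualPoly_dualPoly hσinv h1 h4]; exact Ne.symm hd
    rw [labelBlock, if_neg hd', dualPoly_pow]

variable [Finite F]

lemma nsForm_bsum_labelBlock (hσinv : ∀ a, σ (σ a) = a) (hsq : IsSqrt σ sqrtS)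
    (t : List (F[X] × ℕ)) (ht : ∀ x ∈ t, IsLabel x) :
    NSForm (matForm σ (bsum (t.map (labelBlock σ sqrtS))).2) (t.map (labelED σ)).sum := by
  induction t with
  | nil =>
    have : Subsingleton (Fin (bsum (List.map (labelBlock σ sqrtS) [])).1 → F) :=
      inferInstanceAs (Subsingleton (Fin 0 → F))
    exact nsForm_of_subsingleton _
  | cons x t ih =>
    rw [List.forall_mem_cons] at ht
    rw [List.map_cons, List.map_cons, List.sum_cons]
    exact ((nsForm_labelBlock hσinv hsq ht.1).prod (ih ht.2)).congr
      (matForm_bsum_cons_isom _ _).symm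

theorem exists_bStarCong_bsum (hchar : (2 : F) ≠ 0) (hσinv : ∀ a, σ (σ a) = a)
    (hσ : σ ≠ RingHom.id F) (hsq : IsSqrt σ sqrtS) (X : Block F) :
    ∃ L : List (Block F), (∀ b ∈ L, T1i b ∨ T1ii σ b ∨ T1iii σ sqrtS b) ∧
      BStarCong σ X (bsum L) := by
  have key := exists_isom_bsum (σ := σ) hσinv (fun b => T1i b ∨ T1ii σ b ∨ T1iii σ sqrtS b)
    (fun n hn => Or.inl ⟨n, hn, rfl⟩) ?_ (Fin X.1 → F) (matForm σ X.2)
  · obtain ⟨L, hL, h⟩ := key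
    exact ⟨L, hL, (bStarCong_iff_isom X (bsum L)).2 h⟩
  · intro V _ _ _ B hB
    obtain ⟨s, hs⟩ := hB.exists_nsForm hσinv
    obtain ⟨t, ht, rfl⟩ := exists_labels hσinv s hs.isPrimePowers hs.nonzeroAtZero
      (hs.dualED_eq hσinv)
    refine ⟨t.map (labelBlock σ sqrtS), fun b hb => ?_,
      hs.isom hchar hσinv hσ (nsForm_bsum_labelBlock hσinv hsq t ht)⟩
    obtain ⟨x, hx, rfl⟩ := List.mem_map.1 hb
    exact Or.inr (labelBlock_type (ht x hx))

lemma exists_decomposition (hσinv : ∀ a, σ (σ a) = a) (hsq : IsSqrt σ sqrtS)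
    (L : List (Block F)) (hL : ∀ b ∈ L, T1i b ∨ T1ii σ b ∨ T1iii σ sqrtS b) :
    ∃ (js : Multiset ℕ) (xs : Multiset (F[X] × ℕ)), (∀ n ∈ js, 0 < n) ∧ (∀ x ∈ xs, IsLabel x) ∧
      (L : Multiset (Block F)) = js.map (fun n => ⟨n, J F n 0⟩) + xs.map (labelBlock σ sqrtS) ∧
      (∀ i, Nat.card (nilSet (matForm σ (bsum L).2) i) =
        Nat.card F ^ (js.map fun n => min i ((n + 1) / 2)).sum) ∧
      (∀ i, Nat.card (nilRadSet (matForm σ (bsum L).2) i) =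
        Nat.card F ^ (js.map fun n => if n % 2 = 1 ∧ n < 2 * i then 1 else 0).sum) ∧
      ∀ p : F[X], p.Monic → Irreducible p → ∀ k,
        Nat.card (trajSet (matForm σ (bsum L).2) (p ^ k)) =
          (js.map fun n => Nat.card (trajSet (matForm σ (J F n 0)) (p ^ k))).prod *
            Nat.card F ^ (p.natDegree * kerWeight (xs.map (labelED σ)).sum p k) := by
  induction L with
  | nil =>
    have : Subsingleton (Fin (bsum ([] : List (Block F))).1 → F) :=
      inferInstanceAs (Subsingleton (Fin 0 → F))
    have h : NSForm (matForm σ (bsum ([] : List (Block F))).2) 0 := nsForm_of_subsingleton _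
    exact ⟨0, 0, by simp, by simp, by simp, fun i => by simp [h.card_nilSet],
      fun i => by simp [h.card_nilRadSet], fun p hp hp' k => by simp [h.card_trajSet hp hp']⟩
  | cons b L ih =>
    rw [List.forall_mem_cons] at hL
    obtain ⟨js, xs, h1, h2, h3, h4, h5, h6⟩ := ih hL.2
    have hiso := matForm_bsum_cons_isom (σ := σ) b L
    rcases hL.1 with ⟨n, hn, rfl⟩ | hb
    · refine ⟨n ::ₘ js, xs, Multiset.forall_mem_cons.2 ⟨hn, h1⟩, h2, ?_, fun i => ?_, fun i => ?_,
        fun p hp hp' k => ?_⟩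
      · rw [← Multiset.cons_coe, h3, Multiset.map_cons, Multiset.cons_add]
      · rw [hiso.card_nilSet, card_nilSet_prodForm, card_nilSet_J hσinv, h4, Multiset.map_cons,
          Multiset.sum_cons, pow_add]
      · rw [hiso.card_nilRadSet, card_nilRadSet_prodForm, card_nilRadSet_J hσinv, h5,
          Multiset.map_cons, Multiset.sum_cons, pow_add]
      · rw [hiso.card_trajSet, card_trajSet_prodForm, h6 p hp hp', Multiset.map_cons,
          Multiset.prod_cons, mul_assoc]
    · obtain ⟨x, hx, rfl⟩ := exists_label hb
      have hns := nsForm_labelBlock hσinv hsq hx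
      refine ⟨js, x ::ₘ xs, h1, Multiset.forall_mem_cons.2 ⟨hx, h2⟩, ?_, fun i => ?_, fun i => ?_,
        fun p hp hp' k => ?_⟩
      · rw [← Multiset.cons_coe, h3, Multiset.map_cons, Multiset.add_cons]
      · rw [hiso.card_nilSet, card_nilSet_prodForm, hns.card_nilSet, h4, one_mul]
      · rw [hiso.card_nilRadSet, card_nilRadSet_prodForm, hns.card_nilRadSet, h5, one_mul]
      · rw [hiso.card_trajSet, card_trajSet_prodForm, h6 p hp hp', hns.card_trajSet hp hp',
          Multiset.map_cons, Multiset.sum_cons, kerWeight_add, mul_add, pow_add]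
        ring

theorem exists_perm_equiv1 (hσinv : ∀ a, σ (σ a) = a) (hsq : IsSqrt σ sqrtS)
    {L₁ L₂ : List (Block F)} (hL₁ : ∀ b ∈ L₁, T1i b ∨ T1ii σ b ∨ T1iii σ sqrtS b)
    (hL₂ : ∀ b ∈ L₂, T1i b ∨ T1ii σ b ∨ T1iii σ sqrtS b)
    (h : Isom (matForm σ (bsum L₁).2) (matForm σ (bsum L₂).2)) :
    ∃ L₂' : List (Block F), L₁.Perm L₂' ∧ List.Forall₂ (Equiv1 σ) L₂' L₂ := by
  obtain ⟨js, xs, hj, hx, hL, hnil, hrad, htraj⟩ := exists_decomposition hσinv hsq L₁ hL₁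
  obtain ⟨js', xs', hj', hx', hL', hnil', hrad', htraj'⟩ := exists_decomposition hσinv hsq L₂ hL₂
  have hinj := Nat.pow_right_injective (Finite.one_lt_card (α := F))
  obtain rfl : js = js' := by
    refine multiset_eq_of_weights hj hj' (fun i => hinj ?_) fun i => hinj ?_
    · exact (hnil i).symm.trans ((h.card_nilSet i).trans (hnil' i))
    · exact (hrad i).symm.trans ((h.card_nilRadSet i).trans (hrad' i))
  have hprime : ∀ ys : Multiset (F[X] × ℕ), (∀ x ∈ ys, IsLabel x) →
      IsPrimePowers (ys.map (labelED σ)).sum := by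
    intro ys hys y hy
    obtain ⟨u, hu, hyu⟩ := Multiset.mem_join.1 hy
    obtain ⟨x, hx, rfl⟩ := Multiset.mem_map.1 hu
    exact (nsForm_labelBlock hσinv hsq (hys x hx)).isPrimePowers y hyu
  have hsum : (xs.map (labelED σ)).sum = (xs'.map (labelED σ)).sum := by
    refine (hprime xs hx).eq_of_kerWeight (hprime xs' hx') fun p hp hp' k => ?_
    have h1 := (htraj p hp hp' k).symm.trans ((h.card_trajSet (p ^ k)).trans (htraj' p hp hp' k))
    refine Nat.eq_of_mul_eq_mul_left hp'.natDegree_pos (hinj (Nat.eq_of_mul_eq_mul_left ?_ h1))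
    refine Nat.pos_of_ne_zero fun h0 => ?_
    obtain ⟨n, -, hn⟩ := Multiset.mem_map.1 (Multiset.prod_eq_zero_iff.1 h0)
    exact (card_trajSet_pos (p ^ k)).ne' hn
  refine exists_perm_forall₂_of_rel ?_
  rw [hL, hL']
  refine Multiset.Rel.add (Multiset.rel_refl_of_refl_on fun b _ => Or.inl rfl)
    (Multiset.rel_map.2 ?_)
  exact (rel_labelRel hσinv hx' hsum).mono fun x hxs y _ hxy => hxy.equiv1 hσinv (hx x hxs)

end Classification

theorem stmt1 (F : Type*) [Field F] [Fintype F] (hchar : (2 : F) ≠ 0)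
    (σ : F →+* F) (hσinv : ∀ a, σ (σ a) = a) (hσ : σ ≠ RingHom.id F)
    (sqrtS : (q : Polynomial F) → Mat F q.natDegree)
    (hsqrtS : ∀ (pp : Polynomial F) (l : ℕ), pp.Monic → Irreducible pp → 0 < l →
      (pp ^ l).eval 0 ≠ 0 → dualPoly σ pp = pp →
      IsUnit (sqrtS (pp ^ l)).det ∧
        sqrtS (pp ^ l) = ctr σ (sqrtS (pp ^ l)) * companion F (pp ^ l))
    (n : ℕ) (A : Mat F n) :
    (∃ L : List (Block F), (∀ b ∈ L, T1i b ∨ T1ii σ b ∨ T1iii σ sqrtS b) ∧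
      BStarCong σ ⟨n, A⟩ (bsum L)) ∧
    (∀ L₁ L₂ : List (Block F),
      (∀ b ∈ L₁, T1i b ∨ T1ii σ b ∨ T1iii σ sqrtS b) →
      (∀ b ∈ L₂, T1i b ∨ T1ii σ b ∨ T1iii σ sqrtS b) →
      BStarCong σ ⟨n, A⟩ (bsum L₁) → BStarCong σ ⟨n, A⟩ (bsum L₂) →
      ∃ L₂' : List (Block F), L₁.Perm L₂' ∧ List.Forall₂ (Equiv1 σ) L₂' L₂) := by
  refine ⟨exists_bStarCong_bsum hchar hσinv hσ hsqrtS ⟨n, A⟩, fun L₁ L₂ h₁ h₂ hA₁ hA₂ => ?_⟩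
  exact exists_perm_equiv1 hσinv hsqrtS h₁ h₂
    (((bStarCong_iff_isom _ _).1 hA₁).symm.trans ((bStarCong_iff_isom _ _).1 hA₂))

end Stmt1
end
end Can
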